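/- (Stoll) For each p > 1, the Privalov space N^p with the topology given by the metric d_p is an F-algebra: (N^p, d_p) is a complete metrizable topological vector space over ℂ in which pointwise multiplication is jointly continuous. -/

import Mathlib

open MeasureTheory Filter Set
open scoped ENNReal Topology Real NNReal

noncomputable section

/-- The open unit disk in the complex plane. -/
def unitDisk : Set ℂ := Metric.ball 0 1

/-- The point `r·e^{iθ}`. -/
def circlePt (r θ : ℝ) : ℂ := (r : ℂ) * Complex.exp (θ * Complex.I)

/-- The maximal radial function `Mf(θ) = sup_{0 ≤ r < 1} |f(r e^{iθ})|`, valued in `ℝ≥0∞`. -/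
def maxRad (f : ℂ → ℂ) (θ : ℝ) : ℝ≥0∞ :=
  ⨆ r ∈ Set.Ico (0 : ℝ) 1, (‖f (circlePt r θ)‖₊ : ℝ≥0∞)

/-- `log⁺` on `ℝ≥0∞`. -/
def elogPlus (x : ℝ≥0∞) : ℝ≥0∞ :=
  if x = ∞ then ∞ else ENNReal.ofReal (Real.log x.toReal)

/-- `x ↦ log (1 + x)` on `ℝ≥0∞`. -/
def elog1p (x : ℝ≥0∞) : ℝ≥0∞ :=
  if x = ∞ then ∞ else ENNReal.ofReal (Real.log (1 + x.toReal))

/-- The radial boundary value `f*(e^{iθ}) = lim_{r→1⁻} f(r e^{iθ})`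
(a junk value is returned where the limit does not exist). -/
def radialLimit (f : ℂ → ℂ) (θ : ℝ) : ℂ :=
  limUnder (nhdsWithin (1 : ℝ) (Set.Iio 1)) fun r : ℝ => f (circlePt r θ)

/-- The class `M^p`: holomorphic functions on the unit disk with
`∫₀^{2π} (log⁺ Mf(θ))^p dθ/2π < ∞`. -/
def MpClass (p : ℝ) : Set (ℂ → ℂ) :=
  {f | DifferentiableOn ℂ f unitDisk ∧
    (∫⁻ θ in Set.Ioc 0 (2 * π), elogPlus (maxRad f θ) ^ p) / ENNReal.ofReal (2 * π) < ∞}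

/-- The metric `ρ_p` on `M^p`. -/
def rhoMetric (p : ℝ) (f g : ℂ → ℂ) : ℝ≥0∞ :=
  ((∫⁻ θ in Set.Ioc 0 (2 * π), elog1p (maxRad (f - g) θ) ^ p) /
    ENNReal.ofReal (2 * π)) ^ (1 / p)

/-- The Privalov class `N^p`: holomorphic functions on the unit disk with
`sup_{0≤r<1} ∫₀^{2π} (log⁺|f(re^{iθ})|)^p dθ/2π < ∞`. -/
def NpClass (p : ℝ) : Set (ℂ → ℂ) :=
  {f | DifferentiableOn ℂ f unitDisk ∧
    (⨆ r ∈ Set.Ico (0 : ℝ) 1,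
      (∫⁻ θ in Set.Ioc 0 (2 * π),
        ENNReal.ofReal (Real.log ‖f (circlePt r θ)‖) ^ p) / ENNReal.ofReal (2 * π)) < ∞}

/-- The metric `d_p` on `N^p`, defined via boundary values. -/
def dMetric (p : ℝ) (f g : ℂ → ℂ) : ℝ≥0∞ :=
  ((∫⁻ θ in Set.Ioc 0 (2 * π),
      ENNReal.ofReal (Real.log (1 + ‖radialLimit f θ - radialLimit g θ‖)) ^ p) /
    ENNReal.ofReal (2 * π)) ^ (1 / p)

/-- The Hardy space `H^p`. -/
def HpClass (p : ℝ) : Set (ℂ → ℂ) :=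
  {f | DifferentiableOn ℂ f unitDisk ∧
    (⨆ r ∈ Set.Ico (0 : ℝ) 1,
      (∫⁻ θ in Set.Ioc 0 (2 * π), (‖f (circlePt r θ)‖₊ : ℝ≥0∞) ^ p) /
        ENNReal.ofReal (2 * π)) < ∞}

/-- The Smirnov class `N⁺`. -/
def SmirnovClass : Set (ℂ → ℂ) :=
  {f | DifferentiableOn ℂ f unitDisk ∧
    (∫⁻ θ in Set.Ioc 0 (2 * π), ENNReal.ofReal (Real.log ‖radialLimit f θ‖)) /
      ENNReal.ofReal (2 * π) < ∞ ∧
    Tendsto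
      (fun r : ℝ => (∫⁻ θ in Set.Ioc 0 (2 * π),
        ENNReal.ofReal (Real.log ‖f (circlePt r θ)‖)) / ENNReal.ofReal (2 * π))
      (nhdsWithin (1 : ℝ) (Set.Iio 1))
      (nhds ((∫⁻ θ in Set.Ioc 0 (2 * π),
        ENNReal.ofReal (Real.log ‖radialLimit f θ‖)) / ENNReal.ofReal (2 * π)))}

/-- The normalized Blaschke factor `(|a|/a)·(a − z)/(1 − conj a · z)`. -/
def blaschkeFactor (a z : ℂ) : ℂ :=
  ((‖a‖ : ℂ) / a) * ((a - z) / (1 - (starRingEnd ℂ) a * z))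

/-- `B` is a (finite or infinite) Blaschke product on the unit disk. -/
def IsBlaschkeProduct (B : ℂ → ℂ) : Prop :=
  ∃ m : ℕ,
    (∃ n : ℕ, ∃ a : ℕ → ℂ, (∀ k < n, a k ∈ unitDisk ∧ a k ≠ 0) ∧
      ∀ z ∈ unitDisk, B z = z ^ m * ∏ k ∈ Finset.range n, blaschkeFactor (a k) z) ∨
    (∃ a : ℕ → ℂ, (∀ k, a k ∈ unitDisk ∧ a k ≠ 0) ∧ (Summable fun k => 1 - ‖a k‖) ∧
      ∀ z ∈ unitDisk, B z = z ^ m * ∏' k, blaschkeFactor (a k) z)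

/-- `I` is an ideal of the ring `M^p`. -/
structure IsIdealIn (p : ℝ) (I : Set (ℂ → ℂ)) : Prop where
  subset : I ⊆ MpClass p
  zero_mem : (0 : ℂ → ℂ) ∈ I
  add_mem : ∀ f ∈ I, ∀ g ∈ I, f + g ∈ I
  neg_mem : ∀ f ∈ I, -f ∈ I
  mul_mem : ∀ f ∈ MpClass p, ∀ g ∈ I, f * g ∈ I

/-- `I` is a prime ideal of the ring `M^p`: an ideal such that whenever a product of two
elements of `M^p` lies in `I`, one of the factors lies in `I`. -/
def IsPrimeIdealIn (p : ℝ) (I : Set (ℂ → ℂ)) : Prop :=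
  IsIdealIn p I ∧ ∀ f ∈ MpClass p, ∀ g ∈ MpClass p, f * g ∈ I → f ∈ I ∨ g ∈ I

/-- `I` is a dense subset of the metric space `(M^p, ρ_p)`. -/
def IsDenseIn (p : ℝ) (I : Set (ℂ → ℂ)) : Prop :=
  ∀ f ∈ MpClass p, ∀ ε : ℝ≥0∞, 0 < ε → ∃ g ∈ I, rhoMetric p f g < ε

/-- `I` is an ideal of the ring `N^p`. -/
structure IsIdealInNp (p : ℝ) (I : Set (ℂ → ℂ)) : Prop where
  subset : I ⊆ NpClass p
  zero_mem : (0 : ℂ → ℂ) ∈ I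
  add_mem : ∀ f ∈ I, ∀ g ∈ I, f + g ∈ I
  neg_mem : ∀ f ∈ I, -f ∈ I
  mul_mem : ∀ f ∈ NpClass p, ∀ g ∈ I, f * g ∈ I

/-- `I` is a prime ideal of the ring `N^p`. -/
def IsPrimeIdealInNp (p : ℝ) (I : Set (ℂ → ℂ)) : Prop :=
  IsIdealInNp p I ∧ ∀ f ∈ NpClass p, ∀ g ∈ NpClass p, f * g ∈ I → f ∈ I ∨ g ∈ I

/-- `I` is a dense subset of the metric space `(N^p, d_p)`. -/
def IsDenseInNp (p : ℝ) (I : Set (ℂ → ℂ)) : Prop :=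
  ∀ f ∈ NpClass p, ∀ ε : ℝ≥0∞, 0 < ε → ∃ g ∈ I, dMetric p f g < ε



lemma circlePt_eq (r θ : ℝ) : circlePt r θ = circleMap 0 r θ := by simp [circlePt, circleMap]

lemma two_pi_pos' : (0 : ℝ) < 2 * π := by positivity

/-- trigonometric approximation -/
lemma trig_approx (v : ℂ → ℝ) (hv : ContinuousOn v (Metric.sphere 0 1)) {ε : ℝ} (hε : 0 < ε) :
    ∃ Q : ℂ → ℂ, Differentiable ℂ Q ∧
      ∀ θ : ℝ, |v (circleMap 0 1 θ) - (Q (circleMap 0 1 θ)).re| ≤ ε := by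
  have : Fact ((0 : ℝ) < 2 * π) := ⟨two_pi_pos'⟩
  let φ : C(AddCircle (2 * π), ℂ) :=
    ⟨fun x => (v (AddCircle.toCircle x : ℂ) : ℂ), by
      refine Complex.continuous_ofReal.comp ?_
      refine hv.comp_continuous (by have := AddCircle.continuous_toCircle (T := 2 * π); fun_prop) ?_
      intro x; simpa using Circle.norm_coe _⟩
  have hmem : φ ∈ (Submodule.span ℂ (range <| @fourier (2 * π))).topologicalClosure := by
    rw [span_fourier_closure_eq_top]; trivial
  have hmem' : φ ∈ closure ((Submodule.span ℂ (range <| @fourier (2 * π)) :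
      Submodule ℂ C(AddCircle (2 * π), ℂ)) : Set C(AddCircle (2 * π), ℂ)) := by
    simpa [← Submodule.topologicalClosure_coe] using hmem
  obtain ⟨ψ, hψ, hd⟩ := Metric.mem_closure_iff.1 hmem' ε hε
  have key : ∃ Q₁ Q₂ : ℂ → ℂ, Differentiable ℂ Q₁ ∧ Differentiable ℂ Q₂ ∧
      ∀ x, ψ x = Q₁ (AddCircle.toCircle x) + (starRingEnd ℂ) (Q₂ (AddCircle.toCircle x)) := by
    clear hd
    refine Submodule.span_induction (p := fun ψ _ => ∃ Q₁ Q₂ : ℂ → ℂ, Differentiable ℂ Q₁ ∧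
      Differentiable ℂ Q₂ ∧
      ∀ x, ψ x = Q₁ (AddCircle.toCircle x) + (starRingEnd ℂ) (Q₂ (AddCircle.toCircle x)))
      ?_ ?_ ?_ ?_ hψ
    · rintro _ ⟨n, rfl⟩
      rcases Int.eq_nat_or_neg n with ⟨m, rfl | rfl⟩
      · refine ⟨fun z => z ^ m, fun _ => 0, by fun_prop, by fun_prop, fun x => ?_⟩
        simp [fourier_apply, AddCircle.toCircle_nsmul]
      · refine ⟨fun _ => 0, fun z => z ^ m, by fun_prop, by fun_prop, fun x => ?_⟩
        rw [fourier_neg]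
        simp [fourier_apply, AddCircle.toCircle_nsmul]
    · exact ⟨fun _ => 0, fun _ => 0, by fun_prop, by fun_prop, by simp⟩
    · rintro a b _ _ ⟨P₁, P₂, h1, h2, h3⟩ ⟨Q₁, Q₂, h4, h5, h6⟩
      refine ⟨fun z => P₁ z + Q₁ z, fun z => P₂ z + Q₂ z, by fun_prop, by fun_prop, fun x => ?_⟩
      simp only [ContinuousMap.add_apply, h3, h6, map_add]; ring
    · rintro c a _ ⟨P₁, P₂, h1, h2, h3⟩
      refine ⟨fun z => c * P₁ z, fun z => (starRingEnd ℂ) c * P₂ z, by fun_prop, by fun_prop,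
        fun x => ?_⟩
      simp only [ContinuousMap.smul_apply, h3, smul_eq_mul, map_mul, Complex.conj_conj]; ring
  obtain ⟨Q₁, Q₂, h1, h2, h3⟩ := key
  refine ⟨fun z => Q₁ z + Q₂ z, by fun_prop, fun θ => ?_⟩
  have hc : ((AddCircle.toCircle (T := 2 * π) (θ : AddCircle (2 * π)) : Circle) : ℂ)
      = circleMap 0 1 θ := by
    rw [AddCircle.toCircle_apply_mk, Circle.coe_exp]
    simp [circleMap]
  have h4 := ContinuousMap.dist_apply_le_dist (f := φ) (g := ψ) (θ : AddCircle (2 * π))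
  have h5 : |(φ θ - ψ θ).re| ≤ ε :=
    (Complex.abs_re_le_norm _).trans ((dist_eq_norm (φ θ) (ψ θ) ▸ h4).trans hd.le)
  rw [h3] at h5
  simpa [φ, hc] using h5

/-- analytic majorant of `log (1 + |f|)` -/
lemma exists_majorant (f : ℂ → ℂ) (hf : DiffContOnCl ℂ f (Metric.ball 0 1)) {ε : ℝ} (hε : 0 < ε) :
    ∃ Q : ℂ → ℂ, Differentiable ℂ Q ∧
      (∀ z ∈ Metric.sphere (0 : ℂ) 1, (Q z).re ≤ Real.log (1 + ‖f z‖) + ε) ∧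
      (∀ z ∈ Metric.closedBall (0 : ℂ) 1, Real.log (1 + ‖f z‖) ≤ (Q z).re) := by
  have hcb : ContinuousOn f (Metric.closedBall 0 1) := by
    have := hf.2; rwa [closure_ball _ one_ne_zero] at this
  have hv : ContinuousOn (fun z => Real.log (1 + ‖f z‖) + ε / 2) (Metric.sphere 0 1) := by
    have h1 := hcb.mono Metric.sphere_subset_closedBall
    refine ContinuousOn.add (ContinuousOn.log (by fun_prop) ?_) (by fun_prop)
    intro x _; positivity
  obtain ⟨Q, hQ, hQ2⟩ := trig_approx _ hv (half_pos hε)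
  have hsph : ∀ z ∈ Metric.sphere (0 : ℂ) 1,
      |Real.log (1 + ‖f z‖) + ε / 2 - (Q z).re| ≤ ε / 2 := by
    intro z hz
    have : z ∈ range (circleMap 0 1) := by rw [range_circleMap]; simpa using hz
    obtain ⟨θ, rfl⟩ := this
    exact hQ2 θ
  refine ⟨Q, hQ, fun z hz => ?_, fun z hz => ?_⟩
  · have := abs_le.1 (hsph z hz); linarith
  · -- maximum principle
    obtain ⟨c, hc, hc2⟩ : ∃ c : ℂ, ‖c‖ = 1 ∧ ‖1 + c * f z‖ = 1 + ‖f z‖ := by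
      by_cases h0 : f z = 0
      · exact ⟨1, by simp, by simp [h0]⟩
      · have hne : (‖f z‖ : ℂ) ≠ 0 := by simpa using h0
        refine ⟨‖f z‖ / f z, by simp [h0], ?_⟩
        rw [div_mul_cancel₀ _ h0]
        rw [← Complex.ofReal_one, ← Complex.ofReal_add, Complex.norm_real, Real.norm_eq_abs,
          abs_of_nonneg (by positivity)]
    let W : ℂ → ℂ := fun w => (1 + c * f w) * Complex.exp (-Q w)
    have hW : DiffContOnCl ℂ W (Metric.ball 0 1) := by
      refine ⟨?_, ?_⟩
      · have := hf.1
        intro w hw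
        have h1 := this w hw
        have h2 := (hQ w).differentiableWithinAt (s := Metric.ball 0 1)
        fun_prop
      · have := hf.2
        have h2 := hQ.continuous
        fun_prop
    have hb : ∀ w ∈ frontier (Metric.ball (0 : ℂ) 1), ‖W w‖ ≤ 1 := by
      intro w hw
      rw [frontier_ball _ one_ne_zero] at hw
      have h1 := abs_le.1 (hsph w hw)
      have h2 : ‖1 + c * f w‖ ≤ 1 + ‖f w‖ := by
        refine (norm_add_le _ _).trans ?_
        simp [hc]
      have h3 : ‖Complex.exp (-Q w)‖ ≤ (1 + ‖f w‖)⁻¹ := by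
        rw [Complex.norm_exp, Complex.neg_re, Real.exp_neg]
        gcongr
        rw [← Real.log_le_iff_le_exp (by positivity)]
        linarith
      calc ‖W w‖ = ‖1 + c * f w‖ * ‖Complex.exp (-Q w)‖ := norm_mul _ _
        _ ≤ (1 + ‖f w‖) * (1 + ‖f w‖)⁻¹ := by gcongr
        _ = 1 := mul_inv_cancel₀ (by positivity)
    have h4 := Complex.norm_le_of_forall_mem_frontier_norm_le Metric.isBounded_ball hW hb
      (z := z) (by rwa [closure_ball _ one_ne_zero])
    rw [Real.log_le_iff_le_exp (by positivity)]
    have h5 : (1 + ‖f z‖) * (Real.exp (Q z).re)⁻¹ ≤ 1 := by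
      have : ‖W z‖ = (1 + ‖f z‖) * (Real.exp (Q z).re)⁻¹ := by
        simp only [W, norm_mul, hc2, Complex.norm_exp, Complex.neg_re, Real.exp_neg]
      linarith
    have := mul_le_mul_of_nonneg_right h5 (Real.exp_pos (Q z).re).le
    rwa [mul_assoc, inv_mul_cancel₀ (Real.exp_pos _).ne', mul_one, one_mul] at this

lemma poisson_nonneg {z ζ : ℂ} (hz : z ∈ Metric.ball (0 : ℂ) 1) (hζ : ζ ∈ Metric.sphere (0 : ℂ) 1) :
    0 ≤ poissonKernel 0 z ζ := by
  rw [poissonKernel_def]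
  have h1 : ‖z‖ < 1 := by simpa using hz
  have h2 : ‖ζ‖ = 1 := by simpa using hζ
  have := norm_nonneg z
  apply div_nonneg _ (by positivity)
  simp only [sub_zero, h2]; nlinarith

lemma poisson_le {z ζ : ℂ} (hz : z ∈ Metric.ball (0 : ℂ) 1) (hζ : ζ ∈ Metric.sphere (0 : ℂ) 1) :
    poissonKernel 0 z ζ ≤ (1 + ‖z‖) / (1 - ‖z‖) := by
  rw [poissonKernel_eq_re_herglotzRieszKernel]
  simpa [herglotzRieszKernel_def] using re_herglotzRieszKernel_le hζ hz

lemma poisson_continuousOn {z : ℂ} (hz : z ∈ Metric.ball (0 : ℂ) 1) :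
    ContinuousOn (poissonKernel 0 z) (Metric.sphere 0 1) := by
  rw [poissonKernel_eq_re_herglotzRieszKernel]
  have := continuousOn_herglotzRieszKernel_sphere (c := 0) (R := 1) hz
  rw [abs_one] at this
  exact Complex.continuous_re.comp_continuousOn this

lemma poisson_re (Q : ℂ → ℂ) (hQ : DiffContOnCl ℂ Q (Metric.ball 0 1)) {z : ℂ}
    (hz : z ∈ Metric.ball (0 : ℂ) 1) :
    Real.circleAverage (fun ζ => poissonKernel 0 z ζ * (Q ζ).re) 0 1 = (Q z).re := by
  have h := hQ.circleAverage_poissonKernel_smul hz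
  have hc : ContinuousOn (poissonKernel 0 z • Q) (Metric.sphere 0 1) := by
    refine (poisson_continuousOn hz).smul (hQ.2.mono ?_)
    rw [closure_ball _ one_ne_zero]; exact Metric.sphere_subset_closedBall
  have h2 := (Complex.reCLM.circleAverage_comp_comm (hc.circleIntegrable zero_le_one))
  rw [h] at h2
  rw [← Complex.reCLM_apply, ← h2]
  congr 1
  ext ζ
  simp

/-- Poisson-subharmonicity of `log (1 + |f|)`. -/
lemma key_closed (f : ℂ → ℂ) (hf : DiffContOnCl ℂ f (Metric.ball 0 1)) {z : ℂ}
    (hz : z ∈ Metric.ball (0 : ℂ) 1) :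
    Real.log (1 + ‖f z‖) ≤
      Real.circleAverage (fun ζ => poissonKernel 0 z ζ * Real.log (1 + ‖f ζ‖)) 0 1 := by
  refine le_of_forall_pos_le_add fun ε hε => ?_
  obtain ⟨Q, hQ, h1, h2⟩ := exists_majorant f hf hε
  have hP := poisson_continuousOn hz
  have hcs : ContinuousOn f (Metric.sphere 0 1) := hf.2.mono (by
    rw [closure_ball _ one_ne_zero]; exact Metric.sphere_subset_closedBall)
  have hl : ContinuousOn (fun ζ => Real.log (1 + ‖f ζ‖)) (Metric.sphere 0 1) := by
    refine ContinuousOn.log (by fun_prop) ?_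
    intro x _; positivity
  have hone : Real.circleAverage (fun ζ => poissonKernel 0 z ζ * ε) 0 1 = ε := by
    simpa using poisson_re (fun _ => (ε : ℂ)) diffContOnCl_const hz
  calc Real.log (1 + ‖f z‖) ≤ (Q z).re := h2 z (Metric.ball_subset_closedBall hz)
    _ = Real.circleAverage (fun ζ => poissonKernel 0 z ζ * (Q ζ).re) 0 1 :=
        (poisson_re Q hQ.diffContOnCl hz).symm
    _ ≤ Real.circleAverage (fun ζ => poissonKernel 0 z ζ * Real.log (1 + ‖f ζ‖)
          + poissonKernel 0 z ζ * ε) 0 1 := by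
        refine Real.circleAverage_mono ?_ ?_ ?_
        · refine ContinuousOn.circleIntegrable zero_le_one (hP.mul ?_)
          exact (Complex.continuous_re.comp hQ.continuous).continuousOn
        · refine ContinuousOn.circleIntegrable zero_le_one ?_
          exact (hP.mul hl).add (hP.mul continuousOn_const)
        · intro ζ hζ
          rw [abs_one] at hζ
          rw [← mul_add]
          exact mul_le_mul_of_nonneg_left (h1 ζ hζ) (poisson_nonneg hz hζ)
    _ = _ := by
        rw [Real.circleAverage_fun_add
          (f₁ := fun ζ => poissonKernel 0 z ζ * Real.log (1 + ‖f ζ‖))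
          (f₂ := fun ζ => poissonKernel 0 z ζ * ε)
          (ContinuousOn.circleIntegrable zero_le_one (hP.mul hl))
          (ContinuousOn.circleIntegrable zero_le_one (hP.mul continuousOn_const)), hone]

/-- `log (1 + |z|)` as an extended nonnegative real. -/
def lg (z : ℂ) : ℝ≥0∞ := ENNReal.ofReal (Real.log (1 + ‖z‖))

lemma lg_continuous : Continuous lg := by
  refine ENNReal.continuous_ofReal.comp (Continuous.log (by fun_prop) ?_)
  intro x; positivity

lemma lg_ne_top (z : ℂ) : lg z ≠ ∞ := ENNReal.ofReal_ne_top

lemma lg_mono {a b : ℂ} (h : ‖a‖ ≤ ‖b‖) : lg a ≤ lg b :=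
  ENNReal.ofReal_le_ofReal (Real.log_le_log (by positivity) (by linarith))

lemma lg_zero : lg 0 = 0 := by simp [lg]

lemma lg_eq_zero {a : ℂ} (h : lg a = 0) : a = 0 := by
  rw [lg, ENNReal.ofReal_eq_zero] at h
  by_contra h0
  have : 0 < ‖a‖ := by simpa using h0
  have := Real.log_pos (show 1 < 1 + ‖a‖ by linarith)
  linarith

lemma lg_neg (a : ℂ) : lg (-a) = lg a := by simp [lg]

lemma lg_aux {a b c : ℂ} (h : 1 + ‖c‖ ≤ (1 + ‖a‖) * (1 + ‖b‖)) : lg c ≤ lg a + lg b := by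
  rw [lg, lg, lg, ← ENNReal.ofReal_add (Real.log_nonneg (by simp)) (Real.log_nonneg (by simp)),
    ← Real.log_mul (by positivity) (by positivity)]
  exact ENNReal.ofReal_le_ofReal (Real.log_le_log (by positivity) h)

lemma lg_add (a b : ℂ) : lg (a + b) ≤ lg a + lg b := by
  apply lg_aux
  have := norm_add_le a b
  nlinarith [norm_nonneg a, norm_nonneg b, mul_nonneg (norm_nonneg a) (norm_nonneg b)]

lemma lg_sub (a b : ℂ) : lg (a - b) ≤ lg a + lg b := by
  rw [sub_eq_add_neg, ← lg_neg b]; exact lg_add _ _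

lemma lg_mul (a b : ℂ) : lg (a * b) ≤ lg a + lg b := by
  apply lg_aux
  rw [norm_mul]
  nlinarith [norm_nonneg a, norm_nonneg b, mul_nonneg (norm_nonneg a) (norm_nonneg b)]

/-- normalised Poisson kernel. -/
def kk (z : ℂ) (θ : ℝ) : ℝ≥0∞ := ENNReal.ofReal (poissonKernel 0 z (circlePt 1 θ) / (2 * π))

lemma circlePt_norm {r : ℝ} (hr : 0 ≤ r) (θ : ℝ) : ‖circlePt r θ‖ = r := by
  simp [circlePt_eq, hr]

lemma circlePt_sphere (θ : ℝ) : circlePt 1 θ ∈ Metric.sphere (0 : ℂ) 1 := by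
  simp [circlePt_norm]

lemma circlePt_continuous : Continuous (fun x : ℝ × ℝ => circlePt x.1 x.2) := by
  unfold circlePt; fun_prop

lemma circlePt_cont2 (r : ℝ) : Continuous (fun θ : ℝ => circlePt r θ) := by
  unfold circlePt; fun_prop

lemma circlePt_cont1 (θ : ℝ) : Continuous (fun r : ℝ => circlePt r θ) := by
  unfold circlePt; fun_prop

lemma circlePt_mem {r : ℝ} (hr : r ∈ Ico (0 : ℝ) 1) (θ : ℝ) : circlePt r θ ∈ unitDisk := by
  simp [unitDisk, circlePt_norm hr.1, hr.2]

lemma kk_continuous {z : ℂ} (hz : z ∈ unitDisk) : Continuous (kk z) := by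
  refine ENNReal.continuous_ofReal.comp (Continuous.div_const ?_ _)
  exact (poisson_continuousOn hz).comp_continuous (circlePt_cont2 1) circlePt_sphere

lemma avg_lint {z : ℂ} (hz : z ∈ unitDisk) {g : ℂ → ℝ} (hg : ContinuousOn g (Metric.sphere 0 1))
    (hg0 : ∀ ζ ∈ Metric.sphere (0 : ℂ) 1, 0 ≤ g ζ) :
    ENNReal.ofReal (Real.circleAverage (fun ζ => poissonKernel 0 z ζ * g ζ) 0 1) =
      ∫⁻ θ in Ioc 0 (2 * π), kk z θ * ENNReal.ofReal (g (circlePt 1 θ)) := by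
  have hc : Continuous fun θ : ℝ => poissonKernel 0 z (circlePt 1 θ) * g (circlePt 1 θ) :=
    ((poisson_continuousOn hz).mul hg).comp_continuous (circlePt_cont2 1) circlePt_sphere
  rw [Real.circleAverage_def, intervalIntegral.integral_of_le two_pi_pos'.le, smul_eq_mul,
    ← integral_const_mul]
  simp_rw [← circlePt_eq]
  rw [ofReal_integral_eq_lintegral_ofReal]
  · refine lintegral_congr fun θ => ?_
    rw [kk, ← ENNReal.ofReal_mul
      (div_nonneg (poisson_nonneg hz (circlePt_sphere θ)) two_pi_pos'.le)]
    congr 1; ring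
  · exact ((hc.const_mul _).integrableOn_Icc (μ := volume) (a := 0) (b := 2 * π)).mono_set
      Ioc_subset_Icc_self
  · refine ae_of_all _ fun θ => ?_
    exact mul_nonneg (by positivity)
      (mul_nonneg (poisson_nonneg hz (circlePt_sphere θ)) (hg0 _ (circlePt_sphere θ)))

lemma lint_kk {z : ℂ} (hz : z ∈ unitDisk) : ∫⁻ θ in Ioc 0 (2 * π), kk z θ = 1 := by
  have h := avg_lint hz (g := fun _ => 1) continuousOn_const (by simp)
  have h2 := poisson_re (fun _ => (1 : ℂ)) diffContOnCl_const hz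
  simp only [Complex.one_re] at h2
  rw [h2] at h
  simpa using h.symm

lemma kk_le {z : ℂ} (hz : z ∈ unitDisk) (θ : ℝ) :
    kk z θ ≤ ENNReal.ofReal ((1 + ‖z‖) / (1 - ‖z‖) / (2 * π)) := by
  refine ENNReal.ofReal_le_ofReal ?_
  gcongr
  exact poisson_le hz (circlePt_sphere θ)

lemma kk_symm {r : ℝ} (hr : r ∈ Ico (0 : ℝ) 1) (θ φ : ℝ) :
    kk (circlePt r φ) θ = kk (circlePt r θ) φ := by
  have h : ‖circlePt 1 θ - circlePt r φ‖ = ‖circlePt 1 φ - circlePt r θ‖ := by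
    have e : circlePt 1 φ - circlePt r θ = Complex.exp ((θ + φ : ℝ) * Complex.I) *
        (starRingEnd ℂ) (circlePt 1 θ - circlePt r φ) := by
      simp only [circlePt, map_sub, map_mul, Complex.conj_ofReal, ← Complex.exp_conj,
        Complex.conj_I, mul_sub]
      have h1 : Complex.exp ((θ + φ : ℝ) * Complex.I) =
        Complex.exp (θ * Complex.I) * Complex.exp (φ * Complex.I) := by
        rw [← Complex.exp_add]; push_cast; ring_nf
      have h2 : Complex.exp (θ * -Complex.I) = (Complex.exp (θ * Complex.I))⁻¹ := by
        rw [← Complex.exp_neg]; ring_nf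
      have h3 : Complex.exp (φ * -Complex.I) = (Complex.exp (φ * Complex.I))⁻¹ := by
        rw [← Complex.exp_neg]; ring_nf
      rw [h1, h2, h3]
      field_simp [Complex.exp_ne_zero]
    rw [e, norm_mul, Complex.norm_exp_ofReal_mul_I, one_mul, RCLike.norm_conj]
  simp only [kk, poissonKernel_def, sub_zero, circlePt_norm hr.1, circlePt_norm zero_le_one, h]

lemma key_lint (f : ℂ → ℂ) (hf : DiffContOnCl ℂ f (Metric.ball 0 1)) {z : ℂ}
    (hz : z ∈ unitDisk) :
    lg (f z) ≤ ∫⁻ θ in Ioc 0 (2 * π), kk z θ * lg (f (circlePt 1 θ)) := by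
  have hcs : ContinuousOn f (Metric.sphere 0 1) := hf.2.mono (by
    rw [closure_ball _ one_ne_zero]; exact Metric.sphere_subset_closedBall)
  have hl : ContinuousOn (fun ζ => Real.log (1 + ‖f ζ‖)) (Metric.sphere 0 1) := by
    refine ContinuousOn.log (by fun_prop) ?_
    intro x _; positivity
  have h := avg_lint hz hl (fun ζ _ => Real.log_nonneg (by simp))
  refine (ENNReal.ofReal_le_ofReal (key_closed f hf hz)).trans_eq h

/-- dilation -/
lemma dilate_mem {r : ℝ} (hr : r ∈ Ico (0 : ℝ) 1) {z : ℂ} (hz : z ∈ Metric.closedBall (0 : ℂ) 1) :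
    (r : ℂ) * z ∈ unitDisk := by
  have : ‖z‖ ≤ 1 := by simpa using hz
  simp only [unitDisk, Metric.mem_ball, dist_zero_right, norm_mul, Complex.norm_real,
    Real.norm_eq_abs, abs_of_nonneg hr.1]
  nlinarith [hr.1, hr.2, norm_nonneg z]

lemma dilate_diffCont {f : ℂ → ℂ} (hf : DifferentiableOn ℂ f unitDisk) {r : ℝ}
    (hr : r ∈ Ico (0 : ℝ) 1) : DiffContOnCl ℂ (fun z => f (r * z)) (Metric.ball 0 1) := by
  refine DifferentiableOn.diffContOnCl ?_
  rw [closure_ball _ one_ne_zero]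
  exact hf.comp (by fun_prop) (fun z hz => dilate_mem hr hz)

lemma dilate_circlePt (r θ : ℝ) : (r : ℂ) * circlePt 1 θ = circlePt r θ := by
  simp [circlePt]

lemma circ_continuous {f : ℂ → ℂ} (hf : DifferentiableOn ℂ f unitDisk) {r : ℝ}
    (hr : r ∈ Ico (0 : ℝ) 1) : Continuous (fun θ => f (circlePt r θ)) :=
  hf.continuousOn.comp_continuous (circlePt_cont2 r) (circlePt_mem hr)

/-- uniform `L^p` bound reformulation -/
lemma mem_Np_iff {p : ℝ} (hp : 1 < p) (f : ℂ → ℂ) :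
    f ∈ NpClass p ↔ DifferentiableOn ℂ f unitDisk ∧ ∃ B : ℝ≥0∞, B ≠ ∞ ∧
      ∀ r ∈ Ico (0 : ℝ) 1, ∫⁻ θ in Ioc 0 (2 * π), lg (f (circlePt r θ)) ^ p ≤ B := by
  have hp0 : 0 < p := by linarith
  have h2 : ENNReal.ofReal (2 * π) ≠ 0 := by simpa using two_pi_pos'
  have h2' : ENNReal.ofReal (2 * π) ≠ ∞ := ENNReal.ofReal_ne_top
  unfold NpClass
  simp only [mem_ofPred_eq]
  refine and_congr_right fun hf => ⟨fun h => ?_, fun ⟨B, hB, h⟩ => ?_⟩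
  · set S := ⨆ r ∈ Ico (0 : ℝ) 1, (∫⁻ θ in Set.Ioc 0 (2 * π),
        ENNReal.ofReal (Real.log ‖f (circlePt r θ)‖) ^ p) / ENNReal.ofReal (2 * π) with hS
    refine ⟨2 ^ (p - 1) * (ENNReal.ofReal (Real.log 2) ^ p * ENNReal.ofReal (2 * π) +
      S * ENNReal.ofReal (2 * π)), ?_, fun r hr => ?_⟩
    · refine ENNReal.mul_ne_top (ENNReal.rpow_ne_top_of_nonneg (by linarith) (by simp)) ?_
      refine ENNReal.add_ne_top.2 ⟨ENNReal.mul_ne_top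
        (ENNReal.rpow_ne_top_of_nonneg hp0.le ENNReal.ofReal_ne_top) h2',
        ENNReal.mul_ne_top h.ne h2'⟩
    · have hle : ∀ θ, lg (f (circlePt r θ)) ^ p ≤ 2 ^ (p - 1) * (ENNReal.ofReal (Real.log 2) ^ p
          + ENNReal.ofReal (Real.log ‖f (circlePt r θ)‖) ^ p) := by
        intro θ
        refine le_trans ?_ (ENNReal.rpow_add_le_mul_rpow_add_rpow _ _ hp.le)
        refine ENNReal.rpow_le_rpow ?_ hp0.le
        set x := ‖f (circlePt r θ)‖ with hx
        have hx0 : 0 ≤ x := norm_nonneg _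
        rw [lg, ← hx]
        rcases le_total x 1 with h1 | h1
        · refine le_trans (ENNReal.ofReal_le_ofReal ?_) le_self_add
          exact Real.log_le_log (by positivity) (by linarith)
        · rw [← ENNReal.ofReal_add (Real.log_nonneg (by norm_num)) (Real.log_nonneg h1),
            ← Real.log_mul (by norm_num) (by linarith)]
          exact ENNReal.ofReal_le_ofReal (Real.log_le_log (by positivity) (by linarith))
      refine (lintegral_mono hle).trans ?_
      rw [lintegral_const_mul' _ _ (ENNReal.rpow_ne_top_of_nonneg (by linarith) (by simp)),
        lintegral_add_left measurable_const]
      gcongr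
      · simp
      · have : (∫⁻ θ in Set.Ioc 0 (2 * π),
          ENNReal.ofReal (Real.log ‖f (circlePt r θ)‖) ^ p) / ENNReal.ofReal (2 * π) ≤ S := by
          rw [hS]; exact le_iSup₂_of_le r hr le_rfl
        exact (ENNReal.div_le_iff h2 h2').1 this
  · refine lt_of_le_of_lt (iSup₂_le fun r hr => ?_)
      (ENNReal.div_lt_top hB h2)
    refine ENNReal.div_le_div_right ((lintegral_mono fun θ => ?_).trans (h r hr)) _
    refine ENNReal.rpow_le_rpow (ENNReal.ofReal_le_ofReal ?_) hp0.le
    rcases eq_or_lt_of_le (norm_nonneg (f (circlePt r θ))) with h0 | h0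
    · rw [← h0]; simp
    · exact Real.log_le_log h0 (by linarith)

/-- The class of functions with radial limits almost everywhere. -/
def HasRad (f : ℂ → ℂ) : Prop :=
  ∀ᵐ θ ∂(volume.restrict (Ioc 0 (2 * π))),
    Tendsto (fun r : ℝ => f (circlePt r θ)) (𝓝[<] 1) (𝓝 (radialLimit f θ))

lemma radialLimit_eq {f : ℂ → ℂ} {θ : ℝ} {l : ℂ}
    (h : Tendsto (fun r : ℝ => f (circlePt r θ)) (𝓝[<] 1) (𝓝 l)) : radialLimit f θ = l :=
  h.limUnder_eq

lemma hasRad_of_exists {f : ℂ → ℂ} (h : ∀ᵐ θ ∂(volume.restrict (Ioc 0 (2 * π))),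
    ∃ l, Tendsto (fun r : ℝ => f (circlePt r θ)) (𝓝[<] 1) (𝓝 l)) : HasRad f := by
  filter_upwards [h] with θ ⟨l, hl⟩
  rwa [radialLimit_eq hl]

/-- radii tending to one -/
def RR (n : ℕ) : ℝ := 1 - 1 / ((n : ℝ) + 1)

lemma RR_mem (n : ℕ) : RR n ∈ Ico (0 : ℝ) 1 := by
  have h : (0 : ℝ) < (n : ℝ) + 1 := by positivity
  have h1 : 1 / ((n : ℝ) + 1) ≤ 1 := by
    rw [div_le_one h]; have : (0 : ℝ) ≤ n := by positivity
    linarith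
  have h2 : 0 < 1 / ((n : ℝ) + 1) := by positivity
  constructor <;> unfold RR <;> linarith

lemma RR_tendsto' : Tendsto RR atTop (𝓝 1) := by
  have := (tendsto_one_div_add_atTop_nhds_zero_nat (𝕜 := ℝ)).const_sub 1
  show Tendsto (fun n : ℕ => 1 - 1 / ((n : ℝ) + 1)) atTop (𝓝 1)
  simpa using this

lemma RR_tendsto : Tendsto RR atTop (𝓝[<] 1) :=
  tendsto_nhdsWithin_iff.2 ⟨RR_tendsto', Eventually.of_forall fun n => (RR_mem n).2⟩

lemma HasRad.aemeasurable {f : ℂ → ℂ} (hd : DifferentiableOn ℂ f unitDisk) (hf : HasRad f) :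
    AEMeasurable (radialLimit f) (volume.restrict (Ioc 0 (2 * π))) := by
  refine aemeasurable_of_tendsto_metrizable_ae (u := atTop)
    (f := fun n θ => f (circlePt (RR n) θ))
    (fun n => (circ_continuous hd (RR_mem n)).measurable.aemeasurable) ?_
  filter_upwards [hf] with θ hθ
  exact hθ.comp RR_tendsto

lemma trunc_ineq {p : ℝ} (hp : 1 < p) (u : ℝ≥0∞) (hu : u ≠ ∞) (M : ℕ) (hM : 0 < M) :
    u ≤ min u M + ((M : ℝ≥0∞) ^ (p - 1))⁻¹ * u ^ p := by
  rcases le_total u M with h | h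
  · rw [min_eq_left h]; exact le_self_add
  · refine le_trans ?_ le_add_self
    have hM0 : (M : ℝ≥0∞) ≠ 0 := by simpa using hM.ne'
    have hu0 : u ≠ 0 := fun h0 => by rw [h0] at h; exact hM0 (le_antisymm h (by simp))
    rw [mul_comm, ← div_eq_mul_inv, ENNReal.le_div_iff_mul_le]
    · calc u * (M : ℝ≥0∞) ^ (p - 1) ≤ u * u ^ (p - 1) := by
            gcongr
        _ = u ^ (1 : ℝ) * u ^ (p - 1) := by rw [ENNReal.rpow_one]
        _ = u ^ p := by rw [← ENNReal.rpow_add _ _ hu0 hu]; ring_nf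
    · left; simp [ENNReal.rpow_eq_zero_iff, hM.ne']
    · left; exact ENNReal.rpow_ne_top_of_nonneg (by linarith) (by simp)

lemma trunc_tendsto {p : ℝ} (hp : 1 < p) :
    Tendsto (fun M : ℕ => ((M : ℝ≥0∞) ^ (p - 1))⁻¹) atTop (𝓝 0) := by
  have h1 : Tendsto (fun M : ℕ => (M : ℝ≥0∞) ^ (p - 1)) atTop (𝓝 ∞) := by
    have := (ENNReal.continuous_rpow_const (y := p - 1)).tendsto ∞
    rw [ENNReal.top_rpow_of_pos (by linarith)] at this
    exact this.comp ENNReal.tendsto_nat_nhds_top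
  simpa using tendsto_inv_iff.2 h1

lemma dilate_tendsto {f : ℂ → ℂ} (hf : DifferentiableOn ℂ f unitDisk) {z : ℂ}
    (hz : z ∈ unitDisk) : Tendsto (fun n => f ((RR n : ℂ) * z)) atTop (𝓝 (f z)) := by
  have h1 : ContinuousAt f z :=
    (hf.differentiableAt (Metric.isOpen_ball.mem_nhds hz)).continuousAt
  have h2 : Tendsto (fun n => (RR n : ℂ) * z) atTop (𝓝 z) := by
    have := ((Complex.continuous_ofReal.tendsto 1).comp RR_tendsto').mul_const z
    simpa using this
  exact h1.tendsto.comp h2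

lemma key_rad {p : ℝ} (hp : 1 < p) {f : ℂ → ℂ} (hf : f ∈ NpClass p) (hr : HasRad f) {z : ℂ}
    (hz : z ∈ unitDisk) :
    lg (f z) ≤ ∫⁻ θ in Ioc 0 (2 * π), kk z θ * lg (radialLimit f θ) := by
  obtain ⟨hd, B, hB, hfB⟩ := (mem_Np_iff hp f).1 hf
  set C := ENNReal.ofReal ((1 + ‖z‖) / (1 - ‖z‖) / (2 * π)) with hC
  have hCt : C ≠ ∞ := ENNReal.ofReal_ne_top
  have hkm : Measurable (kk z) := (kk_continuous hz).measurable
  have step : ∀ M : ℕ, 0 < M → lg (f z) ≤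
      (∫⁻ θ in Ioc 0 (2 * π), kk z θ * lg (radialLimit f θ)) +
        ((M : ℝ≥0∞) ^ (p - 1))⁻¹ * (C * B) := by
    intro M hM
    have hn : ∀ n, lg (f ((RR n : ℂ) * z)) ≤
        (∫⁻ θ in Ioc 0 (2 * π), kk z θ * min (lg (f (circlePt (RR n) θ))) M) +
        ((M : ℝ≥0∞) ^ (p - 1))⁻¹ * (C * B) := by
      intro n
      have hum : Measurable (fun θ => lg (f (circlePt (RR n) θ))) :=
        (lg_continuous.comp (circ_continuous hd (RR_mem n))).measurable
      refine (key_lint _ (dilate_diffCont hd (RR_mem n)) hz).trans ?_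
      simp only [dilate_circlePt]
      calc ∫⁻ θ in Ioc 0 (2 * π), kk z θ * lg (f (circlePt (RR n) θ))
          ≤ ∫⁻ θ in Ioc 0 (2 * π), (kk z θ * min (lg (f (circlePt (RR n) θ))) M +
            ((M : ℝ≥0∞) ^ (p - 1))⁻¹ * (C * lg (f (circlePt (RR n) θ)) ^ p)) := by
            refine lintegral_mono fun θ => ?_
            calc kk z θ * lg (f (circlePt (RR n) θ)) ≤ kk z θ * (min (lg (f (circlePt (RR n) θ))) M +
              ((M : ℝ≥0∞) ^ (p - 1))⁻¹ * lg (f (circlePt (RR n) θ)) ^ p) := by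
                  gcongr
                  exact trunc_ineq hp _ (lg_ne_top _) M hM
              _ = kk z θ * min (lg (f (circlePt (RR n) θ))) M +
              ((M : ℝ≥0∞) ^ (p - 1))⁻¹ * (kk z θ * lg (f (circlePt (RR n) θ)) ^ p) := by ring
              _ ≤ _ := by
                  gcongr
                  exact kk_le hz θ
        _ = (∫⁻ θ in Ioc 0 (2 * π), kk z θ * min (lg (f (circlePt (RR n) θ))) M) +
            ((M : ℝ≥0∞) ^ (p - 1))⁻¹ * (C * ∫⁻ θ in Ioc 0 (2 * π),
              lg (f (circlePt (RR n) θ)) ^ p) := by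
            rw [lintegral_add_left (by fun_prop), lintegral_const_mul _ (by fun_prop),
              lintegral_const_mul _ (by fun_prop)]
        _ ≤ _ := by
            gcongr
            exact hfB _ (RR_mem n)
    have hl1 : Tendsto (fun n => lg (f ((RR n : ℂ) * z))) atTop (𝓝 (lg (f z))) :=
      (lg_continuous.tendsto _).comp (dilate_tendsto hd hz)
    have hl2 : Tendsto (fun n => ∫⁻ θ in Ioc 0 (2 * π),
        kk z θ * min (lg (f (circlePt (RR n) θ))) M) atTop
        (𝓝 (∫⁻ θ in Ioc 0 (2 * π), kk z θ * min (lg (radialLimit f θ)) M)) := by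
      refine tendsto_lintegral_of_dominated_convergence (fun θ => kk z θ * M) ?_ ?_ ?_ ?_
      · intro n
        have hum : Measurable (fun θ => lg (f (circlePt (RR n) θ))) :=
          (lg_continuous.comp (circ_continuous hd (RR_mem n))).measurable
        fun_prop
      · intro n
        refine ae_of_all _ fun θ => ?_
        dsimp only
        gcongr
        exact min_le_right _ _
      · rw [lintegral_mul_const _ hkm, lint_kk hz]; simp
      · filter_upwards [hr] with θ hθ
        have h1 : Tendsto (fun n => lg (f (circlePt (RR n) θ))) atTop (𝓝 (lg (radialLimit f θ))) :=
          (lg_continuous.tendsto _).comp (hθ.comp RR_tendsto)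
        refine ENNReal.Tendsto.const_mul (h1.min tendsto_const_nhds) (Or.inr ?_)
        exact ENNReal.ofReal_ne_top
    refine (le_of_tendsto_of_tendsto' hl1 (hl2.add_const _) hn).trans ?_
    gcongr
    exact min_le_left _ _
  have hlim : Tendsto (fun M : ℕ => (∫⁻ θ in Ioc 0 (2 * π), kk z θ * lg (radialLimit f θ)) +
        ((M : ℝ≥0∞) ^ (p - 1))⁻¹ * (C * B)) atTop
        (𝓝 ((∫⁻ θ in Ioc 0 (2 * π), kk z θ * lg (radialLimit f θ)) + 0 * (C * B))) :=
    (ENNReal.Tendsto.mul_const (trunc_tendsto hp)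
      (Or.inr (ENNReal.mul_ne_top hCt hB))).const_add _
  rw [zero_mul, add_zero] at hlim
  refine ge_of_tendsto hlim ?_
  filter_upwards [eventually_gt_atTop 0] with M hM using step M hM

lemma Np_of_bound {p : ℝ} (hp : 1 < p) {f : ℂ → ℂ} (hd : DifferentiableOn ℂ f unitDisk) {C : ℝ}
    (hb : ∀ z ∈ unitDisk, ‖f z‖ ≤ C) : f ∈ NpClass p := by
  refine (mem_Np_iff hp f).2 ⟨hd, lg C ^ p * ENNReal.ofReal (2 * π), ?_, fun r hr => ?_⟩
  · exact ENNReal.mul_ne_top (ENNReal.rpow_ne_top_of_nonneg (by linarith) (lg_ne_top _))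
      ENNReal.ofReal_ne_top
  · calc _ ≤ ∫⁻ θ in Ioc 0 (2 * π), lg C ^ p := by
          refine lintegral_mono fun θ => ENNReal.rpow_le_rpow (lg_mono ?_) (by linarith)
          rw [Complex.norm_real]
          exact (hb _ (circlePt_mem hr θ)).trans (le_abs_self C)
      _ = _ := by simp

lemma Np_of_le {p : ℝ} (hp : 1 < p) {f g h : ℂ → ℂ} (hf : f ∈ NpClass p) (hg : g ∈ NpClass p)
    (hd : DifferentiableOn ℂ h unitDisk) (hle : ∀ z, lg (h z) ≤ lg (f z) + lg (g z)) :
    h ∈ NpClass p := by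
  obtain ⟨hfd, B, hB, hfB⟩ := (mem_Np_iff hp f).1 hf
  obtain ⟨hgd, B', hB', hgB⟩ := (mem_Np_iff hp g).1 hg
  refine (mem_Np_iff hp h).2 ⟨hd, 2 ^ (p - 1) * (B + B'), ?_, fun r hr => ?_⟩
  · refine ENNReal.mul_ne_top (ENNReal.rpow_ne_top_of_nonneg (by linarith) (by simp)) ?_
    exact ENNReal.add_ne_top.2 ⟨hB, hB'⟩
  · have hum : Measurable (fun θ => lg (f (circlePt r θ))) :=
        (lg_continuous.comp (circ_continuous hfd hr)).measurable
    calc _ ≤ ∫⁻ θ in Ioc 0 (2 * π), 2 ^ (p - 1) * (lg (f (circlePt r θ)) ^ p +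
            lg (g (circlePt r θ)) ^ p) := by
          refine lintegral_mono fun θ => ?_
          refine le_trans ?_ (ENNReal.rpow_add_le_mul_rpow_add_rpow _ _ hp.le)
          exact ENNReal.rpow_le_rpow (hle _) (by linarith)
      _ = 2 ^ (p - 1) * ((∫⁻ θ in Ioc 0 (2 * π), lg (f (circlePt r θ)) ^ p) +
            ∫⁻ θ in Ioc 0 (2 * π), lg (g (circlePt r θ)) ^ p) := by
          rw [lintegral_const_mul' _ _ (ENNReal.rpow_ne_top_of_nonneg (by linarith) (by simp)),
            lintegral_add_left (by fun_prop)]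
      _ ≤ _ := by
          gcongr
          · exact hfB r hr
          · exact hgB r hr

lemma Np_add {p : ℝ} (hp : 1 < p) {f g : ℂ → ℂ} (hf : f ∈ NpClass p) (hg : g ∈ NpClass p) :
    f + g ∈ NpClass p :=
  Np_of_le hp hf hg (hf.1.add hg.1) fun _ => lg_add _ _

lemma Np_sub {p : ℝ} (hp : 1 < p) {f g : ℂ → ℂ} (hf : f ∈ NpClass p) (hg : g ∈ NpClass p) :
    f - g ∈ NpClass p :=
  Np_of_le hp hf hg (hf.1.sub hg.1) fun _ => lg_sub _ _

lemma Np_mul {p : ℝ} (hp : 1 < p) {f g : ℂ → ℂ} (hf : f ∈ NpClass p) (hg : g ∈ NpClass p) :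
    f * g ∈ NpClass p :=
  Np_of_le hp hf hg (hf.1.mul hg.1) fun _ => lg_mul _ _

lemma Np_const {p : ℝ} (hp : 1 < p) (c : ℂ) : (fun _ => c : ℂ → ℂ) ∈ NpClass p :=
  Np_of_bound hp (C := ‖c‖) (by fun_prop) (fun z _ => le_rfl)

lemma smul_eq_const_mul (c : ℂ) (f : ℂ → ℂ) : c • f = (fun _ => c : ℂ → ℂ) * f := by
  ext z; simp

lemma Np_smul {p : ℝ} (hp : 1 < p) (c : ℂ) {f : ℂ → ℂ} (hf : f ∈ NpClass p) :
    c • f ∈ NpClass p := by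
  rw [smul_eq_const_mul]; exact Np_mul hp (Np_const hp c) hf

lemma deriv_formula {H : ℂ → ℂ} (hH : DiffContOnCl ℂ H (Metric.ball 0 1)) {r : ℝ} (hr0 : 0 < r)
    (hr1 : r < 1) :
    deriv H r = Real.circleAverage
      (fun ζ => (ζ / (ζ - r) ^ 2 - ζ / (1 - r * ζ) ^ 2) * H ζ) 0 1 := by
  have hcb : ContinuousOn H (Metric.closedBall 0 1) := by
    have := hH.2; rwa [closure_ball _ one_ne_zero] at this
  have hcs : ContinuousOn H (Metric.sphere 0 1) := hcb.mono Metric.sphere_subset_closedBall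
  have hwb : (r : ℂ) ∈ Metric.ball (0 : ℂ) 1 := by simp [abs_of_pos hr0, hr1]
  have hden1 : ∀ ζ ∈ Metric.sphere (0 : ℂ) 1, ∀ w ∈ Metric.ball (0 : ℂ) 1, ζ - w ≠ 0 := by
    intro ζ hζ w hw h
    rw [sub_eq_zero] at h
    rw [mem_sphere_zero_iff_norm] at hζ
    rw [mem_ball_zero_iff, ← h] at hw
    linarith
  have hden2 : ∀ ζ ∈ Metric.closedBall (0 : ℂ) 1, (1 : ℂ) - r * ζ ≠ 0 := by
    intro ζ hζ h
    rw [mem_closedBall_zero_iff] at hζ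
    have h1 : (r : ℂ) * ζ = 1 := (sub_eq_zero.1 h).symm
    have h2 := congrArg norm h1
    rw [norm_mul, Complex.norm_real, Real.norm_eq_abs, abs_of_pos hr0, norm_one] at h2
    nlinarith [norm_nonneg ζ]
  -- derivative of the Herglotz integral
  have h1 := hasDerivAt_circleAverage_herglotzRieszKernel_smul
    (hcs.circleIntegrable zero_le_one) hwb
  have hA : ∀ w ∈ Metric.ball (0 : ℂ) 1,
      Real.circleAverage (fun ζ ↦ herglotzRieszKernel 0 w ζ • H ζ) 0 1 = 2 * H w - H 0 := by
    intro w hw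
    have e1 := DiffContOnCl.circleAverage_smul_div (f := H) (c := 0) (R := 1)
      (by rwa [abs_one]) (w := w) (by rwa [abs_one])
    have e2 := DiffContOnCl.circleAverage (f := H) (c := 0) (R := 1) (by rwa [abs_one])
    have e3 : Real.circleAverage (fun ζ ↦ herglotzRieszKernel 0 w ζ • H ζ) 0 1 =
        Real.circleAverage (fun ζ ↦ (2 : ℂ) • (((ζ - 0) / (ζ - w)) • H ζ) - H ζ) 0 1 := by
      refine Real.circleAverage_congr_sphere fun ζ hζ => ?_
      rw [abs_one] at hζ
      have := hden1 ζ hζ w hw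
      simp only [herglotzRieszKernel_def, smul_eq_mul, sub_zero]
      field_simp
      ring
    have hci : CircleIntegrable (fun ζ ↦ (2 : ℂ) • (((ζ - 0) / (ζ - w)) • H ζ)) 0 1 := by
      refine ContinuousOn.circleIntegrable zero_le_one ?_
      have hq : ContinuousOn (fun ζ : ℂ => (ζ - 0) / (ζ - w)) (Metric.sphere 0 1) :=
        ContinuousOn.div (by fun_prop) (by fun_prop) (fun ζ hζ => hden1 ζ hζ w hw)
      exact (hq.smul hcs).const_smul (2 : ℂ)
    rw [e3, Real.circleAverage_fun_sub hci (hcs.circleIntegrable zero_le_one), e2,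
      Real.circleAverage_fun_smul, e1, smul_eq_mul]
  have h2 : HasDerivAt (fun w => 2 * H w - H 0) (2 * deriv H r) (r : ℂ) := by
    have := (hH.1.differentiableAt (Metric.isOpen_ball.mem_nhds hwb)).hasDerivAt
    exact (this.const_mul 2).sub_const _
  have h3 : HasDerivAt (fun w => 2 * H w - H 0)
      (Real.circleAverage (fun ζ ↦ (2 * ζ / (ζ - r) ^ 2) • H ζ) 0 1) (r : ℂ) := by
    refine h1.congr_of_eventuallyEq ?_
    filter_upwards [Metric.isOpen_ball.mem_nhds hwb] with w hw
    exact (hA w hw).symm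
  have h4 := h2.unique h3
  have h5 : Real.circleAverage (fun ζ => ζ / (1 - r * ζ) ^ 2 * H ζ) 0 1 = 0 := by
    have hd : DiffContOnCl ℂ (fun ζ : ℂ => ζ / (1 - r * ζ) ^ 2 * H ζ) (Metric.ball 0 |1|) := by
      rw [abs_one]
      refine DiffContOnCl.smul (f := H) (c := fun ζ : ℂ => ζ / (1 - r * ζ) ^ 2) ?_ hH
      refine DifferentiableOn.diffContOnCl ?_
      rw [closure_ball _ one_ne_zero]
      refine DifferentiableOn.div (by fun_prop) (by fun_prop) fun ζ hζ => pow_ne_zero _ (hden2 ζ hζ)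
    rw [hd.circleAverage]; simp
  have hc1 : CircleIntegrable (fun ζ => ζ / (ζ - r) ^ 2 * H ζ) 0 1 := by
    refine ContinuousOn.circleIntegrable zero_le_one ?_
    exact ContinuousOn.mul (ContinuousOn.div (by fun_prop)
        (by fun_prop) (fun ζ hζ => pow_ne_zero _ (hden1 ζ hζ _ hwb))) hcs
  have hc2 : CircleIntegrable (fun ζ => ζ / (1 - r * ζ) ^ 2 * H ζ) 0 1 := by
    refine ContinuousOn.circleIntegrable zero_le_one ?_
    exact ContinuousOn.mul (ContinuousOn.div (by fun_prop)
        (by fun_prop) (fun ζ hζ => pow_ne_zero _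
          (hden2 ζ (Metric.sphere_subset_closedBall hζ)))) hcs
  have h6 : Real.circleAverage (fun ζ ↦ (2 * ζ / (ζ - r) ^ 2) • H ζ) 0 1 =
      2 * Real.circleAverage (fun ζ => ζ / (ζ - r) ^ 2 * H ζ) 0 1 := by
    rw [← smul_eq_mul (2 : ℂ), ← Real.circleAverage_fun_smul]
    congr 1; ext ζ; simp only [smul_eq_mul]; ring
  rw [h6] at h4
  have h7 := mul_left_cancel₀ two_ne_zero h4
  simp_rw [sub_mul]
  rw [Real.circleAverage_fun_sub hc1 hc2, h5, sub_zero, h7]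

lemma kernel_bound {r : ℝ} (hr0 : 0 < r) (hr1 : r < 1) {ζ : ℂ} (hζ : ‖ζ‖ = 1) :
    ‖ζ / (ζ - r) ^ 2 - ζ / (1 - r * ζ) ^ 2‖ =
      (1 - r ^ 2) * (‖ζ - 1‖ * ‖1 + ζ‖) / ‖ζ - r‖ ^ 4 ∧ 0 < ‖ζ - r‖ ∧ ‖ζ - 1‖ ≤ 2 * ‖ζ - r‖ := by
  have hζ0 : ζ ≠ 0 := by intro h; simp [h] at hζ
  have hD : 1 - r ≤ ‖ζ - r‖ := by
    have := norm_sub_norm_le ζ r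
    rwa [hζ, Complex.norm_real, Real.norm_eq_abs, abs_of_pos hr0] at this
  have hDpos : 0 < ‖ζ - r‖ := by linarith
  have hne : ζ - r ≠ 0 := norm_pos_iff.1 hDpos
  have hconj : ζ * (starRingEnd ℂ) ζ = 1 := by
    rw [Complex.mul_conj, Complex.normSq_eq_norm_sq, hζ]; simp
  have hn2 : ‖1 - r * ζ‖ = ‖ζ - r‖ := by
    have : 1 - r * ζ = ζ * (starRingEnd ℂ) (ζ - r) := by
      rw [map_sub, mul_sub, hconj, Complex.conj_ofReal]; ring
    rw [this, norm_mul, hζ, one_mul, RCLike.norm_conj]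
  have hne2 : (1 : ℂ) - r * ζ ≠ 0 := by rw [← norm_pos_iff, hn2]; exact hDpos
  refine ⟨?_, hDpos, ?_⟩
  · have : ζ / (ζ - r) ^ 2 - ζ / (1 - r * ζ) ^ 2 =
        ((1 - r ^ 2 : ℝ) : ℂ) * ((1 - ζ) * (1 + ζ)) * ζ / ((ζ - r) ^ 2 * (1 - r * ζ) ^ 2) := by
      rw [div_sub_div _ _ (pow_ne_zero 2 hne) (pow_ne_zero 2 hne2)]
      congr 1
      push_cast
      ring
    rw [this, norm_div, norm_mul, norm_mul, norm_mul, norm_mul, norm_pow, norm_pow, hn2, hζ,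
      Complex.norm_real, Real.norm_eq_abs, abs_of_pos (by nlinarith), norm_sub_rev 1 ζ]
    ring
  · calc ‖ζ - 1‖ = ‖(ζ - r) - ((1 - r : ℝ) : ℂ)‖ := by push_cast; ring_nf
      _ ≤ ‖ζ - r‖ + ‖((1 - r : ℝ) : ℂ)‖ := norm_sub_le _ _
      _ ≤ _ := by rw [Complex.norm_real, Real.norm_eq_abs, abs_of_pos (by linarith)]; linarith

lemma norm_circleAverage_le {F : ℂ → ℂ} {G : ℂ → ℝ} (hG : ContinuousOn G (Metric.sphere 0 1))
    (h : ∀ ζ ∈ Metric.sphere (0 : ℂ) 1, ‖F ζ‖ ≤ G ζ) :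
    ‖Real.circleAverage F 0 1‖ ≤ Real.circleAverage G 0 1 := by
  rw [Real.circleAverage_def, Real.circleAverage_def, norm_smul, smul_eq_mul, Real.norm_eq_abs,
    abs_of_pos (by positivity)]
  gcongr
  refine intervalIntegral.norm_integral_le_of_norm_le two_pi_pos'.le ?_ ?_
  · refine ae_of_all _ fun θ _ => h _ (by simp)
  · exact hG.circleIntegrable zero_le_one

lemma fatou_pt {H : ℂ → ℂ} (hH : DiffContOnCl ℂ H (Metric.ball 0 1))
    (h0 : ∀ ε > 0, ∃ δ > 0, ∀ ζ : ℂ, ‖ζ‖ = 1 → ‖ζ - 1‖ < δ → ‖H ζ‖ ≤ ε * ‖ζ - 1‖) :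
    Tendsto (fun r : ℝ => deriv H (r : ℂ)) (𝓝[<] 1) (𝓝 0) := by
  have hcb : ContinuousOn H (Metric.closedBall 0 1) := by
    have := hH.2; rwa [closure_ball _ one_ne_zero] at this
  have hcs : ContinuousOn H (Metric.sphere 0 1) := hcb.mono Metric.sphere_subset_closedBall
  obtain ⟨M, hM⟩ := (isCompact_sphere (0 : ℂ) 1).exists_bound_of_continuousOn hcs
  have hM0 : 0 ≤ M := (norm_nonneg _).trans (hM 1 (by simp))
  rw [Metric.tendsto_nhds]
  intro ε' hε'
  set ε := ε' / 16 with hε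
  have hεpos : 0 < ε := by positivity
  obtain ⟨δ, hδ, hδ2⟩ := h0 ε hεpos
  have hlim : Tendsto (fun r : ℝ => (1 - r ^ 2) * (64 * M / δ ^ 4)) (𝓝[<] 1) (𝓝 0) := by
    have : Continuous (fun r : ℝ => (1 - r ^ 2) * (64 * M / δ ^ 4)) := by fun_prop
    have : Tendsto _ (𝓝[<] (1 : ℝ)) _ := (this.tendsto 1).mono_left nhdsWithin_le_nhds
    simpa using this
  have hpos : ∀ᶠ r : ℝ in 𝓝[<] 1, 0 < r :=
    nhdsWithin_le_nhds (lt_mem_nhds zero_lt_one)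
  filter_upwards [hlim.eventually (gt_mem_nhds (show 0 < ε' / 2 by positivity)), hpos,
    self_mem_nhdsWithin] with r hr hr0 hr1
  have hr1 : r < 1 := hr1
  have hwb : (r : ℂ) ∈ Metric.ball (0 : ℂ) 1 := by simp [abs_of_pos hr0, hr1]
  have h1r : 0 < 1 - r ^ 2 := by nlinarith
  rw [dist_zero_right, deriv_formula hH hr0 hr1]
  have hP := poisson_continuousOn hwb
  have hle := norm_circleAverage_le
    (F := fun ζ => (ζ / (ζ - r) ^ 2 - ζ / (1 - r * ζ) ^ 2) * H ζ)
    (G := fun ζ => poissonKernel 0 r ζ * (8 * ε) + poissonKernel 0 r ζ * 0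
      + (1 - r ^ 2) * (64 * M / δ ^ 4))
    (((hP.mul continuousOn_const).add (hP.mul continuousOn_const)).add continuousOn_const) (by
      intro ζ hζ
      have hζ' : ‖ζ‖ = 1 := by simpa using hζ
      obtain ⟨k1, k2, k3⟩ := kernel_bound hr0 hr1 hζ'
      have h1p : ‖1 + ζ‖ ≤ 2 := by
        refine (norm_add_le _ _).trans ?_
        rw [hζ']; norm_num
      have hPk : poissonKernel 0 r ζ = (1 - r ^ 2) / ‖ζ - r‖ ^ 2 := by
        rw [poissonKernel_def]; simp [hζ']
      rw [norm_mul, k1, hPk, mul_zero, add_zero]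
      set D := ‖ζ - r‖ with hD
      set s := ‖ζ - 1‖ with hs
      have hs0 : 0 ≤ s := norm_nonneg _
      by_cases hc : s < δ
      · have e1 := hδ2 ζ hζ' hc
        have : (1 - r ^ 2) * (s * ‖1 + ζ‖) / D ^ 4 * ‖H ζ‖ ≤ (1 - r ^ 2) / D ^ 2 * (8 * ε) := by
          calc (1 - r ^ 2) * (s * ‖1 + ζ‖) / D ^ 4 * ‖H ζ‖
              ≤ (1 - r ^ 2) * (s * 2) / D ^ 4 * (ε * s) := by gcongr
            _ = (1 - r ^ 2) * 2 * ε / D ^ 4 * s ^ 2 := by ring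
            _ ≤ (1 - r ^ 2) * 2 * ε / D ^ 4 * (2 * D) ^ 2 := by gcongr
            _ = _ := by field_simp; ring
        have h3 : 0 ≤ (1 - r ^ 2) * (64 * M / δ ^ 4) := by positivity
        linarith
      · push Not at hc
        have hs2 : s ≤ 2 := by
          refine (norm_sub_le _ _).trans ?_
          rw [hζ']; norm_num
        have hD2 : δ / 2 ≤ D := by linarith
        have : (1 - r ^ 2) * (s * ‖1 + ζ‖) / D ^ 4 * ‖H ζ‖ ≤ (1 - r ^ 2) * (64 * M / δ ^ 4) := by
          calc (1 - r ^ 2) * (s * ‖1 + ζ‖) / D ^ 4 * ‖H ζ‖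
              ≤ (1 - r ^ 2) * (2 * 2) / (δ / 2) ^ 4 * M := by
                gcongr
                exact hM ζ hζ
            _ = _ := by field_simp; ring
        have h3 : 0 ≤ (1 - r ^ 2) / D ^ 2 * (8 * ε) := by positivity
        linarith)
  simp only [mul_zero, add_zero] at hle
  have hone : Real.circleAverage (fun ζ => poissonKernel 0 r ζ * (8 * ε)) 0 1 = 8 * ε := by
    simpa using poisson_re (fun _ => ((8 * ε : ℝ) : ℂ)) diffContOnCl_const hwb
  rw [Real.circleAverage_fun_add (f₁ := fun ζ => poissonKernel 0 r ζ * (8 * ε))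
      (f₂ := fun _ => (1 - r ^ 2) * (64 * M / δ ^ 4))
      ((hP.mul continuousOn_const).circleIntegrable zero_le_one)
      (continuousOn_const.circleIntegrable zero_le_one), hone, Real.circleAverage_const] at hle
  refine hle.trans_lt ?_
  rw [hε]; linarith

lemma arg_bound {ζ : ℂ} (hζ : ‖ζ‖ = 1) : |ζ.arg| ≤ 2 * ‖ζ - 1‖ := by
  have h1 : Complex.exp (Complex.I * ζ.arg) = ζ := by
    have := Complex.norm_mul_exp_arg_mul_I ζ
    rw [hζ] at this
    rw [mul_comm]; simpa using this
  have h2 := Complex.norm_exp_I_mul_ofReal_sub_one ζ.arg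
  rw [h1, norm_mul, Real.norm_eq_abs, Real.norm_eq_abs, abs_two] at h2
  have h3 : |ζ.arg / 2| ≤ π / 2 := by
    rw [abs_div, abs_two]
    have := Complex.abs_arg_le_pi ζ
    linarith
  have h4 := Real.mul_abs_le_abs_sin h3
  rw [abs_div, abs_two] at h4
  have h5 : (1 : ℝ) / 2 ≤ 2 / π := by
    rw [div_le_div_iff₀ (by norm_num) Real.pi_pos]
    linarith [Real.pi_le_four]
  have h6 : (1 : ℝ) / 2 * (|ζ.arg| / 2) ≤ 2 / π * (|ζ.arg| / 2) := by gcongr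
  rw [h2]
  linarith

lemma fatou_pt2 {H : ℂ → ℂ} (hH : DiffContOnCl ℂ H (Metric.ball 0 1)) (h1 : H 1 = 0)
    (hd : HasDerivAt (fun t : ℝ => H (Complex.exp (t * Complex.I))) 0 0) :
    Tendsto (fun r : ℝ => deriv H (r : ℂ)) (𝓝[<] 1) (𝓝 0) := by
  refine fatou_pt hH fun ε hε => ?_
  have h2 := (hasDerivAt_iff_isLittleO.1 hd).def (show 0 < ε / 2 by positivity)
  simp only [Complex.ofReal_zero, zero_mul, Complex.exp_zero, h1, sub_zero, smul_zero] at h2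
  obtain ⟨δ, hδ, h3⟩ := Metric.eventually_nhds_iff.1 h2
  refine ⟨δ / 2, by positivity, fun ζ hζ hζ1 => ?_⟩
  have h4 := arg_bound hζ
  have h5 := h3 (y := ζ.arg) (by rw [dist_zero_right, Real.norm_eq_abs]; linarith)
  have h6 : Complex.exp (ζ.arg * Complex.I) = ζ := by
    have := Complex.norm_mul_exp_arg_mul_I ζ
    rw [hζ] at this
    simpa using this
  rw [h6, Real.norm_eq_abs] at h5
  nlinarith

lemma fatou_deriv {K : ℂ → ℂ} (hK : DiffContOnCl ℂ K (Metric.ball 0 1))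
    (hd : DifferentiableAt ℝ (fun t : ℝ => K (Complex.exp (t * Complex.I))) 0) :
    ∃ l, Tendsto (fun r : ℝ => deriv K (r : ℂ)) (𝓝[<] 1) (𝓝 l) := by
  set b := deriv (fun t : ℝ => K (Complex.exp (t * Complex.I))) 0 with hb
  have hd' := hd.hasDerivAt
  rw [← hb] at hd'
  set B : ℂ := -Complex.I * b with hB
  have hBI : B * Complex.I = b := by
    rw [hB]; linear_combination (-b) * Complex.I_mul_I
  have hexp : HasDerivAt (fun t : ℝ => Complex.exp (t * Complex.I)) Complex.I 0 := by
    have h1 : HasDerivAt (fun t : ℝ => (t : ℂ) * Complex.I) (1 * Complex.I) 0 :=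
      (Complex.ofRealCLM.hasDerivAt (x := (0 : ℝ))).mul_const Complex.I
    simpa using h1.cexp
  have hH : DiffContOnCl ℂ (fun z => K z - ((K 1 - B) + B * z)) (Metric.ball 0 1) := by
    refine hK.sub (Differentiable.diffContOnCl ?_)
    fun_prop
  have h := fatou_pt2 hH (by ring) (by
    have := hd'.sub ((hexp.const_mul B).const_add (K 1 - B))
    rw [hBI, sub_self] at this
    exact this)
  refine ⟨B, ?_⟩
  have h2 := h.add_const B
  rw [zero_add] at h2
  refine h2.congr' ?_
  have hpos : ∀ᶠ r : ℝ in 𝓝[<] 1, 0 < r :=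
    nhdsWithin_le_nhds (lt_mem_nhds zero_lt_one)
  filter_upwards [hpos, self_mem_nhdsWithin] with r hr0 hr1
  have hr1 : r < 1 := hr1
  have hwb : (r : ℂ) ∈ Metric.ball (0 : ℂ) 1 := by simp [abs_of_pos hr0, hr1]
  have e1 := (hK.1.differentiableAt (Metric.isOpen_ball.mem_nhds hwb)).hasDerivAt
  have e2 : HasDerivAt (fun z : ℂ => (K 1 - B) + B * z) (B * 1) (r : ℂ) :=
    ((hasDerivAt_id (r : ℂ)).const_mul B).const_add _
  have e3 := (e1.sub e2).deriv
  have e4 : deriv (fun z => K z - ((K 1 - B) + B * z)) (r : ℂ) = deriv K r - B * 1 := e3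
  rw [e4]; ring

lemma bounded_hasRad {g : ℂ → ℂ} (hg : DifferentiableOn ℂ g unitDisk) {C : ℝ≥0}
    (hb : ∀ z ∈ unitDisk, ‖g z‖ ≤ C) : HasRad g := by
  obtain ⟨G, hG⟩ := DifferentiableOn.isExactOn_ball (c := 0) (r := 1) hg
  have hL : LipschitzOnWith C G (Metric.ball 0 1) :=
    Convex.lipschitzOnWith_of_nnnorm_hasDerivWithin_le (convex_ball 0 1)
      (fun z hz => (hG z hz).hasDerivWithinAt) (fun z hz => hb z hz)
  obtain ⟨K, hK, hGK⟩ := hL.extend_finite_dimension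
  have hKd : ∀ z ∈ Metric.ball (0 : ℂ) 1, HasDerivAt K (g z) z := fun z hz =>
    (hG z hz).congr_of_eventuallyEq (by
      filter_upwards [Metric.isOpen_ball.mem_nhds hz] with w hw using (hGK hw).symm)
  have hKc : DiffContOnCl ℂ K (Metric.ball 0 1) :=
    ⟨fun z hz => (hKd z hz).differentiableAt.differentiableWithinAt, hK.continuous.continuousOn⟩
  have hexpL : LipschitzWith 1 (fun t : ℝ => Complex.exp (t * Complex.I)) := by
    refine LipschitzWith.of_dist_le_mul fun s t => ?_
    have h1 : Complex.exp (s * Complex.I) - Complex.exp (t * Complex.I) =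
        Complex.exp (t * Complex.I) * (Complex.exp (Complex.I * ((s - t : ℝ) : ℂ)) - 1) := by
      rw [mul_sub, mul_one, ← Complex.exp_add]; push_cast; ring_nf
    rw [dist_eq_norm, h1, norm_mul, Complex.norm_exp_ofReal_mul_I, one_mul, NNReal.coe_one, one_mul,
      dist_eq_norm]
    exact Real.norm_exp_I_mul_ofReal_sub_one_le
  have hae := (hK.comp hexpL).ae_differentiableAt_real
  refine hasRad_of_exists ?_
  filter_upwards [ae_restrict_of_ae hae] with θ hθ
  set ζ := Complex.exp (θ * Complex.I) with hζ
  have hζ1 : ‖ζ‖ = 1 := Complex.norm_exp_ofReal_mul_I θ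
  have hmap : MapsTo (fun z => ζ * z) (Metric.ball 0 1) (Metric.ball 0 1) := by
    intro z hz
    rw [mem_ball_zero_iff] at hz ⊢
    rwa [norm_mul, hζ1, one_mul]
  have hK2 : DiffContOnCl ℂ (fun z => K (ζ * z)) (Metric.ball 0 1) :=
    hKc.comp (Differentiable.diffContOnCl (by fun_prop)) hmap
  have hd2 : DifferentiableAt ℝ (fun t : ℝ => K (ζ * Complex.exp (t * Complex.I))) 0 := by
    have h1 : DifferentiableAt ℝ (fun t : ℝ => (K ∘ fun t : ℝ => Complex.exp (t * Complex.I))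
        (θ + t)) 0 := by
      have h0 : DifferentiableAt ℝ (K ∘ fun t : ℝ => Complex.exp (t * Complex.I)) (θ + 0) := by
        rw [add_zero]; exact hθ
      have h2 : DifferentiableAt ℝ (fun t : ℝ => θ + t) 0 := by fun_prop
      exact DifferentiableAt.comp (g := K ∘ fun t : ℝ => Complex.exp (t * Complex.I)) (0 : ℝ) h0 h2
    refine h1.congr_of_eventuallyEq (Eventually.of_forall fun t => ?_)
    simp only [Function.comp, hζ]
    rw [← Complex.exp_add]; push_cast; ring_nf
  obtain ⟨l, hl⟩ := fatou_deriv hK2 hd2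
  refine ⟨ζ⁻¹ * l, ?_⟩
  refine (hl.const_mul ζ⁻¹).congr' ?_
  have hpos : ∀ᶠ r : ℝ in 𝓝[<] 1, 0 < r :=
    nhdsWithin_le_nhds (lt_mem_nhds zero_lt_one)
  filter_upwards [hpos, self_mem_nhdsWithin] with r hr0 hr1
  have hr1 : r < 1 := hr1
  have hwb : (r : ℂ) ∈ Metric.ball (0 : ℂ) 1 := by simp [abs_of_pos hr0, hr1]
  have e1 : HasDerivAt (fun z : ℂ => ζ * z) (ζ * 1) (r : ℂ) := (hasDerivAt_id (r : ℂ)).const_mul ζ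
  have e2 := ((hKd _ (hmap hwb)).comp (r : ℂ) e1).deriv
  have e3 : deriv (fun z => K (ζ * z)) (r : ℂ) = g (ζ * r) * (ζ * 1) := e2
  have e4 : circlePt r θ = ζ * r := by rw [circlePt, mul_comm]
  have hζ0 : ζ ≠ 0 := Complex.exp_ne_zero _
  rw [e3, e4]; field_simp

lemma limit_hol {l : Filter ℕ} [l.NeBot] {F : ℕ → ℂ → ℂ} {H : ℂ → ℂ}
    (hd : ∀ n, DifferentiableOn ℂ (F n) unitDisk) (hb : ∀ n, ∀ z ∈ unitDisk, ‖F n z‖ ≤ 1)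
    (hl : ∀ z ∈ unitDisk, Tendsto (fun n => F n z) l (𝓝 (H z))) :
    DifferentiableOn ℂ H unitDisk := by
  have hopen : IsOpen unitDisk := Metric.isOpen_ball
  have : TendstoLocallyUniformlyOn F H l unitDisk := by
    rw [Metric.tendstoLocallyUniformlyOn_iff]
    intro ε hε x hx
    obtain ⟨R, hR, hRx⟩ := Metric.isOpen_iff.1 hopen x hx
    have hlip : ∀ n, ∀ y ∈ Metric.ball x R, dist (F n y) (F n x) ≤ 2 / R * dist y x := by
      intro n y hy
      refine Complex.dist_le_div_mul_dist_of_mapsTo_ball ((hd n).mono hRx) ?_ hy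
      intro w hw
      rw [Metric.mem_closedBall, dist_eq_norm]
      refine (norm_sub_le _ _).trans ?_
      have := hb n w (hRx hw)
      have := hb n x hx
      linarith
    have hlipH : ∀ y ∈ Metric.ball x R, dist (H y) (H x) ≤ 2 / R * dist y x := fun y hy =>
      le_of_tendsto ((hl y (hRx hy)).dist (hl x hx)) (Eventually.of_forall fun n => hlip n y hy)
    refine ⟨Metric.ball x (min R (ε * R / 6)), nhdsWithin_le_nhds
      (Metric.ball_mem_nhds x (by positivity)), ?_⟩
    filter_upwards [(Metric.tendsto_nhds.1 (hl x hx)) (ε / 3) (by positivity)] with n hn y hy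
    have hyR : y ∈ Metric.ball x R := Metric.ball_subset_ball (min_le_left _ _) hy
    have hyd : dist y x < ε * R / 6 := lt_of_lt_of_le hy (min_le_right _ _)
    have hq : 2 / R * dist y x < ε / 3 := by
      calc 2 / R * dist y x < 2 / R * (ε * R / 6) := by gcongr
        _ = ε / 3 := by field_simp; norm_num
    have h1 := hlip n y hyR
    have h2 := hlipH y hyR
    have h3 := dist_triangle4 (H y) (H x) (F n x) (F n y)
    rw [dist_comm (H x), dist_comm (F n x) (F n y)] at h3
    linarith
  exact this.differentiableOn (Eventually.of_forall hd) hopen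

lemma zero_mem_disk : (0 : ℂ) ∈ unitDisk := by simp [unitDisk]

lemma rpow_aux {p : ℝ} (hp : 1 < p) (u : ℝ≥0∞) : u ≤ 1 + u ^ p := by
  rcases le_total u 1 with h | h
  · exact h.trans le_self_add
  · refine le_trans ?_ le_add_self
    calc u = u ^ (1 : ℝ) := (ENNReal.rpow_one u).symm
      _ ≤ u ^ p := ENNReal.rpow_le_rpow_of_exponent_le h hp.le

lemma nev {p : ℝ} (hp : 1 < p) {f : ℂ → ℂ} (hf : f ∈ NpClass p) :
    ∃ h : ℂ → ℂ, DifferentiableOn ℂ h unitDisk ∧ (∀ z ∈ unitDisk, ‖h z‖ ≤ 1) ∧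
      (∀ z ∈ unitDisk, ‖f z * h z‖ ≤ 1) ∧ h 0 ≠ 0 := by
  obtain ⟨hd, B, hB, hfB⟩ := (mem_Np_iff hp f).1 hf
  have hmaj := fun n => exists_majorant _ (dilate_diffCont hd (RR_mem n)) (zero_lt_one' ℝ)
  choose Q hQd hQ1 hQ2 using hmaj
  have hcl : unitDisk ⊆ Metric.closedBall 0 1 := Metric.ball_subset_closedBall
  have hQ0 : ∀ n, ∀ z ∈ Metric.closedBall (0 : ℂ) 1, 0 ≤ (Q n z).re := fun n z hz =>
    (Real.log_nonneg (by simp)).trans (hQ2 n z hz)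
  set C := ENNReal.ofReal ((1 + ‖(0 : ℂ)‖) / (1 - ‖(0 : ℂ)‖) / (2 * π)) with hC
  set D : ℝ≥0∞ := 2 + C * B with hD
  have hDt : D ≠ ∞ :=
    ENNReal.add_ne_top.2 ⟨by simp, ENNReal.mul_ne_top ENNReal.ofReal_ne_top hB⟩
  have hbd : ∀ n, (Q n 0).re ≤ D.toReal := by
    intro n
    rw [← ENNReal.ofReal_le_iff_le_toReal hDt]
    have e1 := avg_lint zero_mem_disk (g := fun ζ => (Q n ζ).re)
      (Complex.continuous_re.comp (hQd n).continuous).continuousOn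
      (fun ζ hζ => hQ0 n ζ (Metric.sphere_subset_closedBall hζ))
    rw [poisson_re (Q n) (hQd n).diffContOnCl zero_mem_disk] at e1
    have hum : Measurable (fun θ => lg (f (circlePt (RR n) θ))) :=
        (lg_continuous.comp (circ_continuous hd (RR_mem n))).measurable
    have hkm : Measurable (kk 0) := (kk_continuous zero_mem_disk).measurable
    rw [e1]
    calc ∫⁻ θ in Ioc 0 (2 * π), kk 0 θ * ENNReal.ofReal (Q n (circlePt 1 θ)).re
        ≤ ∫⁻ θ in Ioc 0 (2 * π), (kk 0 θ * 2 + C * lg (f (circlePt (RR n) θ)) ^ p) := by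
          refine lintegral_mono fun θ => ?_
          have h1 := hQ1 n _ (circlePt_sphere θ)
          rw [dilate_circlePt] at h1
          calc kk 0 θ * ENNReal.ofReal (Q n (circlePt 1 θ)).re
              ≤ kk 0 θ * (lg (f (circlePt (RR n) θ)) + 1) := by
                gcongr
                refine (ENNReal.ofReal_le_ofReal h1).trans (ENNReal.ofReal_add_le.trans ?_)
                simp [lg]
            _ ≤ kk 0 θ * ((1 + lg (f (circlePt (RR n) θ)) ^ p) + 1) := by
                gcongr; exact rpow_aux hp _
            _ = kk 0 θ * 2 + kk 0 θ * lg (f (circlePt (RR n) θ)) ^ p := by ring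
            _ ≤ _ := by gcongr; exact kk_le zero_mem_disk θ
      _ = 2 + C * ∫⁻ θ in Ioc 0 (2 * π), lg (f (circlePt (RR n) θ)) ^ p := by
          rw [lintegral_add_left (by fun_prop), lintegral_mul_const _ hkm, lint_kk zero_mem_disk,
            lintegral_const_mul _ (by fun_prop), one_mul]
      _ ≤ D := by
          rw [hD]; gcongr; exact hfB _ (RR_mem n)
  set F : ℕ → ℂ → ℂ := fun n z => Complex.exp (-(Q n z)) with hF
  have hFn : ∀ n z, ‖F n z‖ = Real.exp (-(Q n z).re) := by
    intro n z; simp [hF, Complex.norm_exp]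
  have hF1 : ∀ n, ∀ z ∈ unitDisk, ‖F n z‖ ≤ 1 := by
    intro n z hz
    rw [hFn, Real.exp_le_one_iff]
    linarith [hQ0 n z (hcl hz)]
  have hFf : ∀ n, ∀ z ∈ unitDisk, ‖f (RR n * z) * F n z‖ ≤ 1 := by
    intro n z hz
    rw [norm_mul, hFn, Real.exp_neg, ← div_eq_mul_inv, div_le_one (Real.exp_pos _)]
    have h1 := hQ2 n z (hcl hz)
    rw [Real.log_le_iff_le_exp (by positivity)] at h1
    linarith
  have hFd : ∀ n, DifferentiableOn ℂ (F n) unitDisk := fun n =>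
    ((hQd n).neg.cexp).differentiableOn
  have hlim : ∀ z, ∃ w, z ∈ unitDisk →
      Tendsto (fun n => F n z) (hyperfilter ℕ : Filter ℕ) (𝓝 w) := by
    intro z
    by_cases hz : z ∈ unitDisk
    · obtain ⟨w, -, hw⟩ := (isCompact_closedBall (0 : ℂ) 1).ultrafilter_le_nhds'
        ((hyperfilter ℕ).map (fun n => F n z)) (by
          rw [Ultrafilter.mem_map]
          refine Filter.mem_of_superset Filter.univ_mem fun n _ => ?_
          simpa using hF1 n z hz)
      exact ⟨w, fun _ => hw⟩
    · exact ⟨0, fun h => absurd h hz⟩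
  choose h hh using hlim
  have hle : (hyperfilter ℕ : Filter ℕ) ≤ atTop := by
    have := Filter.hyperfilter_le_cofinite (α := ℕ)
    rwa [Nat.cofinite_eq_atTop] at this
  refine ⟨h, limit_hol hFd hF1 hh, fun z hz => ?_, fun z hz => ?_, fun h0 => ?_⟩
  · exact le_of_tendsto (hh z hz).norm (Eventually.of_forall fun n => hF1 n z hz)
  · have := ((dilate_tendsto hd hz).mono_left hle).mul (hh z hz)
    exact le_of_tendsto this.norm (Eventually.of_forall fun n => hFf n z hz)
  · have h1 : Real.exp (-D.toReal) ≤ ‖h 0‖ :=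
      ge_of_tendsto (hh 0 zero_mem_disk).norm (Eventually.of_forall fun n => by
        rw [hFn, Real.exp_le_exp]; linarith [hbd n])
    rw [h0, norm_zero] at h1
    exact absurd h1 (not_le.2 (Real.exp_pos _))

lemma lg_nat_tendsto : Tendsto (fun N : ℕ => lg (N : ℂ)) atTop (𝓝 ∞) := by
  have h1 : Tendsto (fun N : ℕ => Real.log (1 + ‖(N : ℂ)‖)) atTop atTop := by
    refine Real.tendsto_log_atTop.comp ?_
    simp only [Complex.norm_natCast]
    exact tendsto_atTop_add_const_left _ _ tendsto_natCast_atTop_atTop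
  exact ENNReal.tendsto_ofReal_atTop.comp h1

lemma bounded_ne_zero {h : ℂ → ℂ} (hd : DifferentiableOn ℂ h unitDisk)
    (hb : ∀ z ∈ unitDisk, ‖h z‖ ≤ 1) (h0 : h 0 ≠ 0) :
    ∀ᵐ θ ∂(volume.restrict (Ioc 0 (2 * π))), radialLimit h θ ≠ 0 := by
  have hr : HasRad h := bounded_hasRad (C := 1) hd (by simpa using hb)
  have hm := hr.aemeasurable hd
  have hkm : Measurable (kk 0) := (kk_continuous zero_mem_disk).measurable
  have hpos : ∀ᶠ r : ℝ in 𝓝[<] 1, 0 < r :=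
    nhdsWithin_le_nhds (lt_mem_nhds zero_lt_one)
  have hle1 : ∀ᵐ θ ∂(volume.restrict (Ioc 0 (2 * π))), ‖radialLimit h θ‖ ≤ 1 := by
    filter_upwards [hr] with θ hθ
    refine le_of_tendsto hθ.norm ?_
    filter_upwards [hpos, self_mem_nhdsWithin] with r hr0 hr1
    exact hb _ (circlePt_mem ⟨hr0.le, hr1⟩ θ)
  set ind : ℂ → ℝ≥0∞ := Set.indicator {0} 1 with hind
  have hindm : Measurable ind := measurable_one.indicator (measurableSet_singleton 0)
  set m := ∫⁻ θ in Ioc 0 (2 * π), kk 0 θ * ind (radialLimit h θ) with hmdef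
  have step : ∀ N : ℕ, lg (N : ℂ) * m ≤ lg (h 0)⁻¹ := by
    intro N
    have hNd : DifferentiableOn ℂ (fun z => (N : ℂ) * h z) unitDisk := hd.const_mul _
    have hNb : ∀ z ∈ unitDisk, ‖(N : ℂ) * h z‖ ≤ (N : ℝ≥0) := by
      intro z hz
      rw [norm_mul, Complex.norm_natCast]
      simpa using mul_le_mul_of_nonneg_left (hb z hz) (Nat.cast_nonneg N)
    have hNr := bounded_hasRad hNd hNb
    have k1 := key_rad one_lt_two (Np_of_bound one_lt_two hNd hNb) hNr zero_mem_disk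
    have k2 : ∫⁻ θ in Ioc 0 (2 * π), kk 0 θ * lg (radialLimit (fun z => (N : ℂ) * h z) θ) =
        ∫⁻ θ in Ioc 0 (2 * π), kk 0 θ * lg ((N : ℂ) * radialLimit h θ) := by
      refine lintegral_congr_ae ?_
      filter_upwards [hr] with θ hθ
      rw [radialLimit_eq (hθ.const_mul (N : ℂ))]
    rw [k2] at k1
    have hml : AEMeasurable (fun θ => kk 0 θ * lg ((N : ℂ) * radialLimit h θ))
        (volume.restrict (Ioc 0 (2 * π))) :=
      hkm.aemeasurable.mul (lg_continuous.measurable.comp_aemeasurable (hm.const_mul _))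
    have k3 : (∫⁻ θ in Ioc 0 (2 * π), kk 0 θ * lg ((N : ℂ) * radialLimit h θ)) +
        lg (N : ℂ) * m ≤ lg (N : ℂ) := by
      rw [hmdef, ← lintegral_const_mul' _ _ (lg_ne_top _), ← lintegral_add_left' hml]
      calc _ ≤ ∫⁻ θ in Ioc 0 (2 * π), kk 0 θ * lg (N : ℂ) := by
            refine lintegral_mono_ae ?_
            filter_upwards [hle1] with θ hθ
            by_cases hz : radialLimit h θ = 0
            · simp [hz, hind, lg_zero, mul_comm]
            · simp only [hind, Set.indicator, mem_singleton_iff, hz, if_false, mul_zero, add_zero]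
              gcongr
              refine lg_mono ?_
              rw [norm_mul]
              exact mul_le_of_le_one_right (norm_nonneg _) hθ
        _ = _ := by rw [lintegral_mul_const _ hkm, lint_kk zero_mem_disk, one_mul]
    have k4 : lg (N : ℂ) ≤ lg ((N : ℂ) * h 0) + lg (h 0)⁻¹ := by
      have : (N : ℂ) = (N : ℂ) * h 0 * (h 0)⁻¹ := by field_simp
      conv_lhs => rw [this]
      exact lg_mul _ _
    have k5 : lg ((N : ℂ) * h 0) + lg (N : ℂ) * m ≤ lg ((N : ℂ) * h 0) + lg (h 0)⁻¹ :=
      (add_le_add_left k1 _).trans (k3.trans k4)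
    exact (ENNReal.add_le_add_iff_left (lg_ne_top _)).1 k5
  have hm0 : m = 0 := by
    by_contra hne
    have h1 := ENNReal.Tendsto.mul_const (b := m) lg_nat_tendsto (Or.inl ENNReal.top_ne_zero)
    rw [ENNReal.top_mul hne] at h1
    have h2 := le_of_tendsto' h1 step
    exact lg_ne_top _ (top_le_iff.1 h2)
  have haem : AEMeasurable (fun θ => kk 0 θ * ind (radialLimit h θ))
      (volume.restrict (Ioc 0 (2 * π))) := hkm.aemeasurable.mul (hindm.comp_aemeasurable hm)
  rw [hmdef, lintegral_eq_zero_iff' haem] at hm0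
  filter_upwards [hm0] with θ hθ hz
  have hk : kk 0 θ ≠ 0 := by
    have : poissonKernel 0 0 (circlePt 1 θ) = 1 := by
      rw [poissonKernel_def]; simp [circlePt_norm zero_le_one]
    rw [kk, this]
    exact (ENNReal.ofReal_pos.2 (by positivity)).ne'
  simp [hz, hind, hk] at hθ

lemma Np_hasRad {p : ℝ} (hp : 1 < p) {f : ℂ → ℂ} (hf : f ∈ NpClass p) : HasRad f := by
  obtain ⟨h, hd, hb, hfb, h0⟩ := nev hp hf
  have hr : HasRad h := bounded_hasRad (C := 1) hd (by simpa using hb)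
  have hg : HasRad (fun z => f z * h z) :=
    bounded_hasRad (C := 1) (hf.1.mul hd) (by simpa using hfb)
  refine hasRad_of_exists ?_
  filter_upwards [hr, hg, bounded_ne_zero hd hb h0] with θ h1 h2 h3
  refine ⟨_, (h2.div h1 h3).congr' ?_⟩
  filter_upwards [h1.eventually_ne h3] with r hr
  simp only [Pi.div_apply]
  field_simp

/-- normalised arc measure (not normalised) -/
abbrev mu : Measure ℝ := volume.restrict (Ioc 0 (2 * π))

/-- the functional on boundary functions -/
def NN (p : ℝ) (φ : ℝ → ℂ) : ℝ≥0∞ := (∫⁻ θ, lg (φ θ) ^ p ∂mu) ^ (1 / p)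

lemma NN_congr {p : ℝ} {φ ψ : ℝ → ℂ} (h : φ =ᵐ[mu] ψ) : NN p φ = NN p ψ := by
  unfold NN; congr 1
  refine lintegral_congr_ae ?_
  filter_upwards [h] with θ hθ; rw [hθ]

lemma NN_rpow {p : ℝ} (hp : 1 < p) (φ : ℝ → ℂ) : NN p φ ^ p = ∫⁻ θ, lg (φ θ) ^ p ∂mu := by
  rw [NN, one_div, ENNReal.rpow_inv_rpow (by linarith)]

lemma NN_add {p : ℝ} (hp : 1 < p) {φ φ₁ φ₂ : ℝ → ℂ} (h₁ : AEMeasurable φ₁ mu)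
    (h₂ : AEMeasurable φ₂ mu) (h : ∀ᵐ θ ∂mu, lg (φ θ) ≤ lg (φ₁ θ) + lg (φ₂ θ)) :
    NN p φ ≤ NN p φ₁ + NN p φ₂ := by
  refine le_trans ?_ (ENNReal.lintegral_Lp_add_le
    (lg_continuous.measurable.comp_aemeasurable h₁)
    (lg_continuous.measurable.comp_aemeasurable h₂) hp.le)
  refine ENNReal.rpow_le_rpow (lintegral_mono_ae ?_) (by positivity)
  filter_upwards [h] with θ hθ
  exact ENNReal.rpow_le_rpow hθ (by linarith)

/-- normalising constant -/
def cc (p : ℝ) : ℝ≥0∞ := ((ENNReal.ofReal (2 * π))⁻¹) ^ (1 / p)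

lemma cc_ne_zero {p : ℝ} (hp : 1 < p) : cc p ≠ 0 := by
  refine (ENNReal.rpow_pos (ENNReal.inv_pos.2 ENNReal.ofReal_ne_top) ?_).ne'
  simp [Real.pi_pos]

lemma cc_ne_top {p : ℝ} (hp : 1 < p) : cc p ≠ ∞ := by
  have : (0 : ℝ) < 1 / p := by positivity
  refine ENNReal.rpow_ne_top_of_nonneg this.le ?_
  simp [Real.pi_pos]

lemma dM_eq {p : ℝ} (hp : 1 < p) (f g : ℂ → ℂ) :
    dMetric p f g = cc p * NN p (fun θ => radialLimit f θ - radialLimit g θ) := by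
  have : (0 : ℝ) ≤ 1 / p := by positivity
  rw [cc, NN, ← ENNReal.mul_rpow_of_nonneg _ _ this, mul_comm, ← div_eq_mul_inv]
  rfl

lemma rl_meas {p : ℝ} (hp : 1 < p) {f : ℂ → ℂ} (hf : f ∈ NpClass p) :
    AEMeasurable (radialLimit f) mu := (Np_hasRad hp hf).aemeasurable hf.1

lemma rl_sub {p : ℝ} (hp : 1 < p) {f g : ℂ → ℂ} (hf : f ∈ NpClass p) (hg : g ∈ NpClass p) :
    radialLimit (f - g) =ᵐ[mu] fun θ => radialLimit f θ - radialLimit g θ := by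
  filter_upwards [Np_hasRad hp hf, Np_hasRad hp hg] with θ h1 h2
  exact radialLimit_eq (h1.sub h2)

lemma rl_add {p : ℝ} (hp : 1 < p) {f g : ℂ → ℂ} (hf : f ∈ NpClass p) (hg : g ∈ NpClass p) :
    radialLimit (f + g) =ᵐ[mu] fun θ => radialLimit f θ + radialLimit g θ := by
  filter_upwards [Np_hasRad hp hf, Np_hasRad hp hg] with θ h1 h2
  exact radialLimit_eq (h1.add h2)

lemma rl_mul {p : ℝ} (hp : 1 < p) {f g : ℂ → ℂ} (hf : f ∈ NpClass p) (hg : g ∈ NpClass p) :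
    radialLimit (f * g) =ᵐ[mu] fun θ => radialLimit f θ * radialLimit g θ := by
  filter_upwards [Np_hasRad hp hf, Np_hasRad hp hg] with θ h1 h2
  exact radialLimit_eq (h1.mul h2)

lemma rl_const (c : ℂ) (θ : ℝ) : radialLimit (fun _ => c) θ = c :=
  radialLimit_eq tendsto_const_nhds

lemma dM_sub {p : ℝ} (hp : 1 < p) {f g : ℂ → ℂ} (hf : f ∈ NpClass p) (hg : g ∈ NpClass p) :
    dMetric p f g = cc p * NN p (radialLimit (f - g)) := by
  rw [dM_eq hp, NN_congr (rl_sub hp hf hg)]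

lemma fatou_rad {p : ℝ} (hp : 1 < p) {f : ℂ → ℂ} (hf : f ∈ NpClass p) {B : ℝ≥0∞}
    (hB : ∀ r ∈ Ico (0 : ℝ) 1, ∫⁻ θ, lg (f (circlePt r θ)) ^ p ∂mu ≤ B) :
    ∫⁻ θ, lg (radialLimit f θ) ^ p ∂mu ≤ B := by
  have hc : Continuous (fun x : ℝ≥0∞ => x ^ p) := ENNReal.continuous_rpow_const
  have hm : ∀ n, Measurable (fun θ => lg (f (circlePt (RR n) θ)) ^ p) := fun n =>
    (hc.comp (lg_continuous.comp (circ_continuous hf.1 (RR_mem n)))).measurable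
  calc ∫⁻ θ, lg (radialLimit f θ) ^ p ∂mu
      = ∫⁻ θ, liminf (fun n => lg (f (circlePt (RR n) θ)) ^ p) atTop ∂mu := by
        refine lintegral_congr_ae ?_
        filter_upwards [Np_hasRad hp hf] with θ hθ
        have : Tendsto (fun n => lg (f (circlePt (RR n) θ)) ^ p) atTop
            (𝓝 (lg (radialLimit f θ) ^ p)) :=
          ((hc.comp lg_continuous).tendsto _).comp (hθ.comp RR_tendsto)
        exact this.liminf_eq.symm
    _ ≤ liminf (fun n => ∫⁻ θ, lg (f (circlePt (RR n) θ)) ^ p ∂mu) atTop :=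
        lintegral_liminf_le hm
    _ ≤ B := by
        refine (liminf_le_liminf (Eventually.of_forall fun n => hB _ (RR_mem n))).trans ?_
        simp

lemma NN_ne_top {p : ℝ} (hp : 1 < p) {f : ℂ → ℂ} (hf : f ∈ NpClass p) :
    NN p (radialLimit f) ≠ ∞ := by
  obtain ⟨hd, B, hB, hfB⟩ := (mem_Np_iff hp f).1 hf
  refine ENNReal.rpow_ne_top_of_nonneg (by positivity) ?_
  exact ne_top_of_le_ne_top hB (fatou_rad hp hf hfB)

lemma jensen {p : ℝ} (hp : 1 < p) {f : ℂ → ℂ} (hf : f ∈ NpClass p) {z : ℂ} (hz : z ∈ unitDisk) :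
    lg (f z) ^ p ≤ ∫⁻ θ, kk z θ * lg (radialLimit f θ) ^ p ∂mu := by
  have hp0 : 0 < p := by linarith
  have hq : 0 < 1 - 1 / p := by
    have : 1 / p < 1 := by rw [div_lt_one hp0]; exact hp
    linarith
  have hkm : Measurable (kk z) := (kk_continuous hz).measurable
  have hum : AEMeasurable (fun θ => lg (radialLimit f θ)) mu :=
    lg_continuous.measurable.comp_aemeasurable (rl_meas hp hf)
  have h1 := key_rad hp hf (Np_hasRad hp hf) hz
  have h2 := ENNReal.lintegral_mul_norm_pow_le (μ := mu) (f := kk z)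
    (g := fun θ => kk z θ * lg (radialLimit f θ) ^ p) hkm.aemeasurable
    (hkm.aemeasurable.mul (hum.pow_const p)) hq.le (q := 1 / p) (by positivity) (by ring)
  have h3 : ∀ θ, kk z θ ^ (1 - 1 / p) * (kk z θ * lg (radialLimit f θ) ^ p) ^ (1 / p) =
      kk z θ * lg (radialLimit f θ) := by
    intro θ
    rw [ENNReal.mul_rpow_of_nonneg _ _ (by positivity), ← mul_assoc,
      ← ENNReal.rpow_add_of_nonneg _ _ hq.le (by positivity), one_div,
      ENNReal.rpow_rpow_inv hp0.ne', sub_add_cancel, ENNReal.rpow_one]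
  simp_rw [h3] at h2
  rw [lint_kk hz, ENNReal.one_rpow, one_mul] at h2
  calc lg (f z) ^ p ≤ ((∫⁻ θ, kk z θ * lg (radialLimit f θ) ^ p ∂mu) ^ (1 / p)) ^ p :=
        ENNReal.rpow_le_rpow (h1.trans h2) hp0.le
    _ = _ := by rw [one_div, ENNReal.rpow_inv_rpow hp0.ne']

lemma circ_le {p : ℝ} (hp : 1 < p) {f : ℂ → ℂ} (hf : f ∈ NpClass p) {r : ℝ}
    (hr : r ∈ Ico (0 : ℝ) 1) :
    ∫⁻ θ, lg (f (circlePt r θ)) ^ p ∂mu ≤ NN p (radialLimit f) ^ p := by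
  rw [NN_rpow hp]
  have hum : AEMeasurable (fun θ => lg (radialLimit f θ) ^ p) mu :=
    (lg_continuous.measurable.comp_aemeasurable (rl_meas hp hf)).pow_const p
  have hkm : Measurable (fun x : ℝ × ℝ => kk (circlePt r x.1) x.2) := by
    have h1 : Measurable (fun x : ℝ × ℝ => circlePt r x.1) :=
      (circlePt_cont2 r).measurable.comp measurable_fst
    have h2 : Measurable (fun x : ℝ × ℝ => circlePt 1 x.2) :=
      (circlePt_cont2 1).measurable.comp measurable_snd
    simp only [kk, poissonKernel_def]
    fun_prop
  calc ∫⁻ θ, lg (f (circlePt r θ)) ^ p ∂mu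
      ≤ ∫⁻ θ, ∫⁻ φ, kk (circlePt r θ) φ * lg (radialLimit f φ) ^ p ∂mu ∂mu :=
        lintegral_mono fun θ => jensen hp hf (circlePt_mem hr θ)
    _ = ∫⁻ φ, ∫⁻ θ, kk (circlePt r θ) φ * lg (radialLimit f φ) ^ p ∂mu ∂mu := by
        refine lintegral_lintegral_swap ?_
        exact hkm.aemeasurable.mul (hum.comp_snd)
    _ = ∫⁻ φ, lg (radialLimit f φ) ^ p ∂mu := by
        refine lintegral_congr fun φ => ?_
        have hne : lg (radialLimit f φ) ^ p ≠ ∞ :=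
          ENNReal.rpow_ne_top_of_nonneg (by linarith) (lg_ne_top _)
        rw [lintegral_mul_const' _ _ hne]
        simp_rw [kk_symm hr φ]
        rw [lint_kk (circlePt_mem hr φ), one_mul]

lemma pt_le {p : ℝ} (hp : 1 < p) {f : ℂ → ℂ} (hf : f ∈ NpClass p) {ρ : ℝ} (hρ : ρ < 1) {z : ℂ}
    (hz : ‖z‖ ≤ ρ) :
    lg (f z) ≤ ENNReal.ofReal ((1 + ρ) / (1 - ρ) / (2 * π)) ^ (1 / p) * NN p (radialLimit f) := by
  have hp0 : 0 < p := by linarith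
  have hzd : z ∈ unitDisk := by simp only [unitDisk, mem_ball_zero_iff]; linarith
  have hum : AEMeasurable (fun θ => lg (radialLimit f θ) ^ p) mu :=
    (lg_continuous.measurable.comp_aemeasurable (rl_meas hp hf)).pow_const p
  have h1 : lg (f z) ^ p ≤ ENNReal.ofReal ((1 + ρ) / (1 - ρ) / (2 * π)) *
      ∫⁻ θ, lg (radialLimit f θ) ^ p ∂mu := by
    refine (jensen hp hf hzd).trans ?_
    rw [← lintegral_const_mul'' _ hum]
    refine lintegral_mono fun θ => ?_
    dsimp only
    gcongr
    refine (kk_le hzd θ).trans (ENNReal.ofReal_le_ofReal ?_)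
    have := norm_nonneg z
    have : 0 < 1 - ρ := by linarith
    gcongr
    linarith
  rw [NN, ← ENNReal.mul_rpow_of_nonneg _ _ (by positivity)]
  calc lg (f z) = (lg (f z) ^ p) ^ (1 / p) := by rw [one_div, ENNReal.rpow_rpow_inv hp0.ne']
    _ ≤ _ := ENNReal.rpow_le_rpow h1 (by positivity)

lemma NN_zero_iff {p : ℝ} (hp : 1 < p) {f : ℂ → ℂ} (hf : f ∈ NpClass p)
    (h : NN p (radialLimit f) = 0) {z : ℂ} (hz : z ∈ unitDisk) : f z = 0 := by
  have h1 := pt_le hp hf (ρ := ‖z‖) (by simpa [unitDisk] using hz) le_rfl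
  rw [h, mul_zero] at h1
  exact lg_eq_zero (le_antisymm h1 zero_le)

lemma rl_congr {f g : ℂ → ℂ} (h : EqOn f g unitDisk) (θ : ℝ) : radialLimit f θ = radialLimit g θ := by
  unfold radialLimit limUnder
  congr 1
  refine Filter.map_congr ?_
  have hpos : ∀ᶠ r : ℝ in 𝓝[<] 1, 0 < r :=
    nhdsWithin_le_nhds (lt_mem_nhds zero_lt_one)
  filter_upwards [hpos, self_mem_nhdsWithin] with r hr0 hr1
  exact h (circlePt_mem ⟨hr0.le, hr1⟩ θ)

lemma lg_natmul (M : ℕ) (w : ℂ) : lg ((M : ℂ) * w) ≤ M * lg w := by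
  induction M with
  | zero => simp [lg_zero]
  | succ M ih =>
    push_cast
    rw [add_mul, one_mul, add_mul, one_mul]
    exact (lg_add _ _).trans (by gcongr)

lemma NN_mul_tendsto {p : ℝ} (hp : 1 < p) {φ : ℝ → ℂ} (hφ : AEMeasurable φ mu)
    (hφt : NN p φ ≠ ∞) {κ : ℕ → ℝ → ℂ} (hκ : ∀ n, AEMeasurable (κ n) mu)
    (hlim : Tendsto (fun n => NN p (κ n)) atTop (𝓝 0)) :
    Tendsto (fun n => NN p (fun θ => φ θ * κ n θ)) atTop (𝓝 0) := by
  have hp0 : 0 < p := by linarith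
  set χ : ℕ → ℂ → ℝ≥0∞ := fun M w => if (M : ℝ) < ‖w‖ then lg w else 0 with hχ
  have hχm : ∀ M, Measurable (χ M) := fun M =>
    Measurable.ite (measurableSet_lt measurable_const measurable_norm) lg_continuous.measurable
      measurable_const
  have hbound : ∀ M : ℕ, 1 ≤ M → ∀ n, NN p (fun θ => φ θ * κ n θ) ≤
      M * NN p (κ n) + (∫⁻ θ, χ M (φ θ) ^ p ∂mu) ^ (1 / p) := by
    intro M hM n
    have hM' : (1 : ℝ≥0∞) ≤ M := by exact_mod_cast hM
    have hle : ∀ θ, lg (φ θ * κ n θ) ≤ M * lg (κ n θ) + χ M (φ θ) := by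
      intro θ
      by_cases hc : (M : ℝ) < ‖φ θ‖
      · simp only [hχ, hc, if_true]
        refine (lg_mul _ _).trans ?_
        rw [add_comm]
        gcongr
        exact le_mul_of_one_le_left' hM'
      · simp only [hχ, hc, if_false, add_zero]
        refine le_trans (lg_mono ?_) (lg_natmul M _)
        push Not at hc
        rw [norm_mul, norm_mul, Complex.norm_natCast]
        gcongr
    have h1 := ENNReal.lintegral_Lp_add_le (μ := mu) (p := p) (f := fun θ => M * lg (κ n θ))
      (g := fun θ => χ M (φ θ))
      ((lg_continuous.measurable.comp_aemeasurable (hκ n)).const_mul _)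
      ((hχm M).comp_aemeasurable hφ) hp.le
    have h2 : (∫⁻ θ, (M * lg (κ n θ)) ^ p ∂mu) ^ (1 / p) = M * NN p (κ n) := by
      simp_rw [ENNReal.mul_rpow_of_nonneg _ _ hp0.le]
      rw [lintegral_const_mul' _ _ (ENNReal.rpow_ne_top_of_nonneg hp0.le (by simp)), NN,
        ENNReal.mul_rpow_of_nonneg _ _ (by positivity), one_div, ENNReal.rpow_rpow_inv hp0.ne']
    rw [h2] at h1
    refine le_trans ?_ h1
    refine ENNReal.rpow_le_rpow (lintegral_mono fun θ => ?_) (by positivity)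
    exact ENNReal.rpow_le_rpow (hle θ) hp0.le
  have htail : Tendsto (fun M : ℕ => (∫⁻ θ, χ M (φ θ) ^ p ∂mu) ^ (1 / p)) atTop (𝓝 0) := by
    have h1 : Tendsto (fun M : ℕ => ∫⁻ θ, χ M (φ θ) ^ p ∂mu) atTop (𝓝 (∫⁻ _, 0 ∂mu)) := by
      refine tendsto_lintegral_of_dominated_convergence' (fun θ => lg (φ θ) ^ p) ?_ ?_ ?_ ?_
      · exact fun M => ((hχm M).comp_aemeasurable hφ).pow_const p
      · refine fun M => ae_of_all _ fun θ => ENNReal.rpow_le_rpow ?_ hp0.le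
        simp only [hχ]
        split_ifs
        · exact le_rfl
        · exact zero_le
      · rw [← NN_rpow hp]; exact ENNReal.rpow_ne_top_of_nonneg hp0.le hφt
      · refine ae_of_all _ fun θ => ?_
        refine tendsto_const_nhds.congr' ?_
        obtain ⟨N, hN⟩ := exists_nat_ge ‖φ θ‖
        filter_upwards [eventually_ge_atTop N] with M hM
        have : ¬ ((M : ℝ) < ‖φ θ‖) := not_lt.2 (hN.trans (by exact_mod_cast hM))
        simp [hχ, this, hp0]
    rw [lintegral_zero] at h1
    have h2 := ((ENNReal.continuous_rpow_const (y := 1 / p)).tendsto 0).comp h1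
    rwa [ENNReal.zero_rpow_of_pos (by positivity)] at h2
  rw [ENNReal.tendsto_nhds_zero]
  intro ε hε
  have hε2 : 0 < ε / 2 := ENNReal.half_pos hε.ne'
  obtain ⟨M, hM1, hM2⟩ := ((ENNReal.tendsto_nhds_zero.1 htail _ hε2).and
    (eventually_ge_atTop 1)).exists
  have h3 : Tendsto (fun n => (M : ℝ≥0∞) * NN p (κ n)) atTop (𝓝 0) := by
    have := ENNReal.Tendsto.const_mul (a := (M : ℝ≥0∞)) hlim (Or.inr (by simp))
    rwa [mul_zero] at this
  filter_upwards [ENNReal.tendsto_nhds_zero.1 h3 _ hε2] with n hn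
  refine (hbound M hM2 n).trans ?_
  calc _ ≤ ε / 2 + ε / 2 := add_le_add hn hM1
    _ = ε := ENNReal.add_halves ε

lemma dM_tendsto_iff {p : ℝ} (hp : 1 < p) (F G : ℕ → ℂ → ℂ) :
    Tendsto (fun n => dMetric p (F n) (G n)) atTop (𝓝 0) ↔
    Tendsto (fun n => NN p (fun θ => radialLimit (F n) θ - radialLimit (G n) θ)) atTop (𝓝 0) := by
  simp_rw [dM_eq hp]
  constructor
  · intro h
    have := ENNReal.Tendsto.const_mul (a := (cc p)⁻¹) h
      (Or.inr (ENNReal.inv_ne_top.2 (cc_ne_zero hp)))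
    simp_rw [← mul_assoc, ENNReal.inv_mul_cancel (cc_ne_zero hp) (cc_ne_top hp), one_mul,
      mul_zero] at this
    exact this
  · intro h
    have := ENNReal.Tendsto.const_mul (a := cc p) h (Or.inr (cc_ne_top hp))
    rwa [mul_zero] at this

lemma dM_triangle {p : ℝ} (hp : 1 < p) {f g h : ℂ → ℂ} (hf : f ∈ NpClass p) (hg : g ∈ NpClass p)
    (hh : h ∈ NpClass p) : dMetric p f h ≤ dMetric p f g + dMetric p g h := by
  rw [dM_eq hp, dM_eq hp, dM_eq hp, ← mul_add]
  gcongr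
  refine NN_add hp ((rl_meas hp hf).sub (rl_meas hp hg)) ((rl_meas hp hg).sub (rl_meas hp hh))
    (ae_of_all _ fun θ => ?_)
  refine le_trans (le_of_eq ?_) (lg_add _ _)
  simp

lemma dM_symm (p : ℝ) (f g : ℂ → ℂ) : dMetric p f g = dMetric p g f := by
  unfold dMetric
  simp_rw [norm_sub_rev (radialLimit f _)]

lemma add_cont {p : ℝ} (hp : 1 < p) {F G : ℕ → ℂ → ℂ} {f g : ℂ → ℂ} (hF : ∀ n, F n ∈ NpClass p)
    (hG : ∀ n, G n ∈ NpClass p) (hf : f ∈ NpClass p) (hg : g ∈ NpClass p)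
    (h1 : Tendsto (fun n => dMetric p (F n) f) atTop (nhds 0))
    (h2 : Tendsto (fun n => dMetric p (G n) g) atTop (nhds 0)) :
    Tendsto (fun n => dMetric p (F n + G n) (f + g)) atTop (nhds 0) := by
  have h3 := h1.add h2
  rw [add_zero] at h3
  refine tendsto_of_tendsto_of_tendsto_of_le_of_le tendsto_const_nhds h3 (fun n => zero_le)
    fun n => ?_
  dsimp only
  rw [dM_eq hp, dM_eq hp, dM_eq hp, ← mul_add]
  gcongr
  refine NN_add hp ((rl_meas hp (hF n)).sub (rl_meas hp hf)) ((rl_meas hp (hG n)).sub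
    (rl_meas hp hg)) ?_
  filter_upwards [rl_add hp (hF n) (hG n), rl_add hp hf hg] with θ e1 e2
  rw [e1, e2]
  refine le_trans (le_of_eq ?_) (lg_add _ _)
  congr 1; ring

lemma mul_cont {p : ℝ} (hp : 1 < p) {F G : ℕ → ℂ → ℂ} {f g : ℂ → ℂ} (hF : ∀ n, F n ∈ NpClass p)
    (hG : ∀ n, G n ∈ NpClass p) (hf : f ∈ NpClass p) (hg : g ∈ NpClass p)
    (h1 : Tendsto (fun n => dMetric p (F n) f) atTop (nhds 0))
    (h2 : Tendsto (fun n => dMetric p (G n) g) atTop (nhds 0)) :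
    Tendsto (fun n => dMetric p (F n * G n) (f * g)) atTop (nhds 0) := by
  rw [dM_tendsto_iff hp (fun n => F n) (fun _ => f)] at h1
  rw [dM_tendsto_iff hp (fun n => G n) (fun _ => g)] at h2
  rw [dM_tendsto_iff hp (fun n => F n * G n) (fun _ => f * g)]
  have mF := fun n => (rl_meas hp (hF n)).sub (rl_meas hp hf)
  have mG := fun n => (rl_meas hp (hG n)).sub (rl_meas hp hg)
  have t1 := NN_mul_tendsto hp (rl_meas hp hf) (NN_ne_top hp hf) mG h2
  have t2 := NN_mul_tendsto hp (rl_meas hp hg) (NN_ne_top hp hg) mF h1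
  have t3 := ((h1.add h2).add (t1.add t2))
  simp only [add_zero] at t3
  refine tendsto_of_tendsto_of_tendsto_of_le_of_le tendsto_const_nhds t3 (fun n => zero_le)
    fun n => ?_
  dsimp only
  set a := radialLimit (F n) - radialLimit f with ha
  set b := radialLimit (G n) - radialLimit g with hb
  have ma : AEMeasurable a mu := mF n
  have mb : AEMeasurable b mu := mG n
  have mfb : AEMeasurable (fun θ => radialLimit f θ * b θ) mu := (rl_meas hp hf).mul mb
  have mga : AEMeasurable (fun θ => radialLimit g θ * a θ) mu := (rl_meas hp hg).mul ma
  have s1 : NN p (fun θ => a θ * b θ) ≤ NN p a + NN p b :=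
    NN_add hp ma mb (ae_of_all _ fun θ => lg_mul _ _)
  have s2 : NN p (fun θ => radialLimit f θ * b θ + radialLimit g θ * a θ) ≤
      NN p (fun θ => radialLimit f θ * b θ) + NN p (fun θ => radialLimit g θ * a θ) :=
    NN_add hp mfb mga (ae_of_all _ fun θ => lg_add _ _)
  have s3 : NN p (fun θ => radialLimit (F n * G n) θ - radialLimit (f * g) θ) ≤
      NN p (fun θ => a θ * b θ) +
        NN p (fun θ => radialLimit f θ * b θ + radialLimit g θ * a θ) := by
    refine NN_add hp (ma.mul mb) (mfb.add mga) ?_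
    filter_upwards [rl_mul hp (hF n) (hG n), rl_mul hp hf hg] with θ e1 e2
    rw [e1, e2]
    refine le_trans (le_of_eq ?_) (lg_add _ _)
    congr 1; simp only [ha, hb, Pi.sub_apply]; ring
  exact s3.trans (add_le_add s1 s2)

lemma const_cont {p : ℝ} (hp : 1 < p) {c : ℕ → ℂ} {c₀ : ℂ} (hc : Tendsto c atTop (𝓝 c₀)) :
    Tendsto (fun n => dMetric p (fun _ => c n) (fun _ => c₀)) atTop (𝓝 0) := by
  rw [dM_tendsto_iff hp (fun n _ => c n) (fun _ _ => c₀)]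
  simp only [rl_const, NN]
  have h1 : Tendsto (fun n => lg (c n - c₀)) atTop (𝓝 0) := by
    have := (lg_continuous.tendsto _).comp (hc.sub_const c₀)
    rwa [sub_self, lg_zero] at this
  have h2 := ((ENNReal.continuous_rpow_const (y := p)).tendsto 0).comp h1
  rw [ENNReal.zero_rpow_of_pos (by linarith)] at h2
  have h3 := ENNReal.Tendsto.mul_const (b := mu univ) h2 (Or.inr (measure_ne_top _ _))
  rw [zero_mul] at h3
  have h4 := ((ENNReal.continuous_rpow_const (y := 1 / p)).tendsto 0).comp h3
  rw [ENNReal.zero_rpow_of_pos (by positivity)] at h4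
  simp only [lintegral_const]; exact h4

lemma complete_aux {p : ℝ} (hp : 1 < p) {F : ℕ → ℂ → ℂ} (hF : ∀ n, F n ∈ NpClass p)
    (hC : ∀ η : ℝ≥0∞, 0 < η → ∃ N, ∀ m ≥ N, ∀ n ≥ N, NN p (radialLimit (F m - F n)) ≤ η) :
    ∃ f ∈ NpClass p, ∀ η : ℝ≥0∞, 0 < η → ∃ N, ∀ n ≥ N, NN p (radialLimit (F n - f)) ≤ η := by
  have hp0 : 0 < p := by linarith
  have hU : ∀ ρ : ℝ, ρ < 1 → ∀ ε : ℝ, 0 < ε → ∃ N, ∀ m ≥ N, ∀ n ≥ N, ∀ z : ℂ, ‖z‖ ≤ ρ →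
      dist (F m z) (F n z) < ε := by
    intro ρ hρ ε hε
    set K : ℝ≥0∞ := ENNReal.ofReal ((1 + ρ) / (1 - ρ) / (2 * π)) ^ (1 / p) with hK
    have hKt : K ≠ ∞ := ENNReal.rpow_ne_top_of_nonneg (by positivity) ENNReal.ofReal_ne_top
    have hlε : 0 < lg (ε : ℂ) := by
      rw [pos_iff_ne_zero]
      intro h
      have := lg_eq_zero h
      have h2 : ε = 0 := by exact_mod_cast this
      exact hε.ne' h2
    obtain ⟨η, hη, hKη⟩ : ∃ η : ℝ≥0∞, 0 < η ∧ K * η < lg (ε : ℂ) := by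
      have h1 : Tendsto (fun η : ℝ≥0∞ => K * η) (𝓝[>] 0) (𝓝 0) := by
        have := ENNReal.Tendsto.const_mul (a := K) (tendsto_id (x := 𝓝 (0 : ℝ≥0∞)))
          (Or.inr hKt)
        rw [mul_zero] at this
        exact this.mono_left nhdsWithin_le_nhds
      obtain ⟨η, h2, h3⟩ := ((h1.eventually (gt_mem_nhds hlε)).and self_mem_nhdsWithin).exists
      exact ⟨η, h3, h2⟩
    obtain ⟨N, hN⟩ := hC η hη
    refine ⟨N, fun m hm n hn z hz => ?_⟩
    by_contra hcon
    push Not at hcon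
    rw [dist_eq_norm] at hcon
    have h1 : lg (ε : ℂ) ≤ lg ((F m - F n) z) := by
      refine lg_mono ?_
      rw [Complex.norm_real, Real.norm_eq_abs, abs_of_pos hε]
      exact hcon
    have h2 := pt_le hp (Np_sub hp (hF m) (hF n)) hρ hz
    have h3 : K * NN p (radialLimit (F m - F n)) ≤ K * η := by
      gcongr
      exact hN m hm n hn
    exact absurd (h1.trans (h2.trans h3)) (not_le.2 hKη)
  have hlim : ∀ z ∈ unitDisk, ∃ w, Tendsto (fun n => F n z) atTop (𝓝 w) := by
    intro z hz
    refine cauchySeq_tendsto_of_complete (Metric.cauchySeq_iff.2 fun ε hε => ?_)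
    obtain ⟨N, hN⟩ := hU ‖z‖ (by simpa [unitDisk] using hz) ε hε
    exact ⟨N, fun m hm n hn => hN m hm n hn z le_rfl⟩
  choose! f hf using hlim
  have hopen : IsOpen unitDisk := Metric.isOpen_ball
  have hloc : TendstoLocallyUniformlyOn F f atTop unitDisk := by
    rw [tendstoLocallyUniformlyOn_iff_forall_isCompact hopen]
    intro S hS hSc
    have hr : ∃ ρ < 1, ∀ z ∈ S, ‖z‖ ≤ ρ := by
      rcases S.eq_empty_or_nonempty with rfl | hne
      · exact ⟨0, by norm_num, by simp⟩
      · obtain ⟨z₀, hz₀, hmax⟩ := hSc.exists_isMaxOn hne continuous_norm.continuousOn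
        exact ⟨‖z₀‖, by simpa [unitDisk] using hS hz₀, fun z hz => hmax hz⟩
    obtain ⟨ρ, hρ, hSρ⟩ := hr
    refine UniformCauchySeqOn.tendstoUniformlyOn_of_tendsto ?_ (fun z hz => hf z (hS hz))
    rw [Metric.uniformCauchySeqOn_iff]
    intro ε hε
    obtain ⟨N, hN⟩ := hU ρ hρ ε hε
    exact ⟨N, fun m hm n hn z hz => hN m hm n hn z (hSρ z hz)⟩
  have hfd : DifferentiableOn ℂ f unitDisk :=
    hloc.differentiableOn (Eventually.of_forall fun n => (hF n).1) hopen
  have hcirc : ∀ η : ℝ≥0∞, ∀ N n, (∀ m ≥ N, NN p (radialLimit (F n - F m)) ≤ η) →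
      ∀ r ∈ Ico (0 : ℝ) 1, ∫⁻ θ, lg ((F n - f) (circlePt r θ)) ^ p ∂mu ≤ η ^ p := by
    intro η N n hN r hr
    have hc : Continuous (fun x : ℝ≥0∞ => x ^ p) := ENNReal.continuous_rpow_const
    have hm : ∀ m, Measurable (fun θ => lg ((F n - F m) (circlePt r θ)) ^ p) := fun m =>
      (hc.comp (lg_continuous.comp (circ_continuous (Np_sub hp (hF n) (hF m)).1 hr))).measurable
    have hl : ∀ θ, lg ((F n - f) (circlePt r θ)) ^ p =
        liminf (fun m => lg ((F n - F m) (circlePt r θ)) ^ p) atTop := by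
      intro θ
      have h1 : Tendsto (fun m => (F n - F m) (circlePt r θ)) atTop
          (𝓝 ((F n - f) (circlePt r θ))) :=
        tendsto_const_nhds.sub (hf _ (circlePt_mem hr θ))
      exact (((hc.comp lg_continuous).tendsto _).comp h1).liminf_eq.symm
    calc ∫⁻ θ, lg ((F n - f) (circlePt r θ)) ^ p ∂mu
        = ∫⁻ θ, liminf (fun m => lg ((F n - F m) (circlePt r θ)) ^ p) atTop ∂mu :=
          lintegral_congr fun θ => hl θ
      _ ≤ liminf (fun m => ∫⁻ θ, lg ((F n - F m) (circlePt r θ)) ^ p ∂mu) atTop :=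
          lintegral_liminf_le hm
      _ ≤ η ^ p := by
          refine liminf_le_of_frequently_le' (Eventually.frequently ?_)
          filter_upwards [eventually_ge_atTop N] with m hmN
          exact (circ_le hp (Np_sub hp (hF n) (hF m)) hr).trans
            (ENNReal.rpow_le_rpow (hN m hmN) hp0.le)
  have hfN : f ∈ NpClass p := by
    obtain ⟨N, hN⟩ := hC 1 one_pos
    have h1 : F N - f ∈ NpClass p := by
      refine (mem_Np_iff hp _).2 ⟨(hF N).1.sub hfd, 1 ^ p, by simp, ?_⟩
      exact hcirc 1 N N (fun m hm => hN N le_rfl m hm)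
    have h2 := Np_sub hp (hF N) h1
    rwa [sub_sub_cancel] at h2
  refine ⟨f, hfN, fun η hη => ?_⟩
  obtain ⟨N, hN⟩ := hC η hη
  refine ⟨N, fun n hn => ?_⟩
  have h1 := fatou_rad hp (Np_sub hp (hF n) hfN) (hcirc η N n (fun m hm => hN n hn m hm))
  rw [← NN_rpow hp] at h1
  exact (ENNReal.rpow_le_rpow_iff hp0).1 h1

lemma complete {p : ℝ} (hp : 1 < p) {F : ℕ → ℂ → ℂ} (hF : ∀ n, F n ∈ NpClass p)
    (hC : ∀ ε : ℝ≥0∞, 0 < ε → ∃ N, ∀ m ≥ N, ∀ n ≥ N, dMetric p (F m) (F n) < ε) :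
    ∃ f ∈ NpClass p, Tendsto (fun n => dMetric p (F n) f) atTop (nhds 0) := by
  obtain ⟨f, hf, h⟩ := complete_aux hp hF (fun η hη => by
    obtain ⟨N, hN⟩ := hC (cc p * η) (by
      rw [pos_iff_ne_zero]; exact mul_ne_zero (cc_ne_zero hp) hη.ne')
    refine ⟨N, fun m hm n hn => ?_⟩
    have h1 := (hN m hm n hn).le
    rw [dM_sub hp (hF m) (hF n)] at h1
    exact (ENNReal.mul_le_mul_iff_right (cc_ne_zero hp) (cc_ne_top hp)).1 h1)
  refine ⟨f, hf, ?_⟩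
  rw [dM_tendsto_iff hp F (fun _ => f)]
  have h2 : ∀ n, NN p (fun θ => radialLimit (F n) θ - radialLimit f θ) =
      NN p (radialLimit (F n - f)) := fun n => (NN_congr (rl_sub hp (hF n) hf)).symm
  simp_rw [h2]
  rw [ENNReal.tendsto_nhds_zero]
  intro ε hε
  obtain ⟨N, hN⟩ := h ε hε
  filter_upwards [eventually_ge_atTop N] with n hn using hN n hn

/-- Stoll. For `p > 1`, the Privalov class `N^p` with the metric `d_p` is an
`F`-algebra: `d_p` is a (finite-valued) metric on `N^p`, `N^p` is a complex algebra, the metric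
space is complete, and addition, scalar multiplication and multiplication are (sequentially)
continuous. -/
theorem Np_is_F_algebra (p : ℝ) (hp : 1 < p) :
    (∀ f ∈ NpClass p, ∀ g ∈ NpClass p, dMetric p f g ≠ ∞) ∧
    (∀ f ∈ NpClass p, ∀ g ∈ NpClass p, (dMetric p f g = 0 ↔ Set.EqOn f g unitDisk)) ∧
    (∀ f ∈ NpClass p, ∀ g ∈ NpClass p, dMetric p f g = dMetric p g f) ∧
    (∀ f ∈ NpClass p, ∀ g ∈ NpClass p, ∀ h ∈ NpClass p,
      dMetric p f h ≤ dMetric p f g + dMetric p g h) ∧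
    (∀ f ∈ NpClass p, ∀ g ∈ NpClass p, f + g ∈ NpClass p) ∧
    (∀ c : ℂ, ∀ f ∈ NpClass p, c • f ∈ NpClass p) ∧
    (∀ f ∈ NpClass p, ∀ g ∈ NpClass p, f * g ∈ NpClass p) ∧
    -- completeness
    (∀ F : ℕ → ℂ → ℂ, (∀ n, F n ∈ NpClass p) →
      (∀ ε : ℝ≥0∞, 0 < ε → ∃ N, ∀ m ≥ N, ∀ n ≥ N, dMetric p (F m) (F n) < ε) →
      ∃ f ∈ NpClass p, Tendsto (fun n => dMetric p (F n) f) atTop (nhds 0)) ∧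
    -- continuity of addition
    (∀ F G : ℕ → ℂ → ℂ, ∀ f g : ℂ → ℂ, (∀ n, F n ∈ NpClass p) → (∀ n, G n ∈ NpClass p) →
      f ∈ NpClass p → g ∈ NpClass p →
      Tendsto (fun n => dMetric p (F n) f) atTop (nhds 0) →
      Tendsto (fun n => dMetric p (G n) g) atTop (nhds 0) →
      Tendsto (fun n => dMetric p (F n + G n) (f + g)) atTop (nhds 0)) ∧
    -- continuity of scalar multiplication
    (∀ c : ℕ → ℂ, ∀ c₀ : ℂ, ∀ F : ℕ → ℂ → ℂ, ∀ f : ℂ → ℂ,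
      (∀ n, F n ∈ NpClass p) → f ∈ NpClass p →
      Tendsto c atTop (nhds c₀) →
      Tendsto (fun n => dMetric p (F n) f) atTop (nhds 0) →
      Tendsto (fun n => dMetric p (c n • F n) (c₀ • f)) atTop (nhds 0)) ∧
    -- joint continuity of multiplication
    (∀ F G : ℕ → ℂ → ℂ, ∀ f g : ℂ → ℂ, (∀ n, F n ∈ NpClass p) → (∀ n, G n ∈ NpClass p) →
      f ∈ NpClass p → g ∈ NpClass p →
      Tendsto (fun n => dMetric p (F n) f) atTop (nhds 0) →
      Tendsto (fun n => dMetric p (G n) g) atTop (nhds 0) →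
      Tendsto (fun n => dMetric p (F n * G n) (f * g)) atTop (nhds 0)) := by
  refine ⟨fun f hf g hg => ?_, fun f hf g hg => ⟨fun h z hz => ?_, fun h => ?_⟩,
    fun f _ g _ => dM_symm p f g, fun f hf g hg h hh => dM_triangle hp hf hg hh,
    fun f hf g hg => Np_add hp hf hg, fun c f hf => Np_smul hp c hf,
    fun f hf g hg => Np_mul hp hf hg, fun F hF hC => complete hp hF hC,
    fun F G f g hF hG hf hg h1 h2 => add_cont hp hF hG hf hg h1 h2,
    fun c c₀ F f hF hf hc h => ?_,
    fun F G f g hF hG hf hg h1 h2 => mul_cont hp hF hG hf hg h1 h2⟩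
  · rw [dM_sub hp hf hg]
    exact ENNReal.mul_ne_top (cc_ne_top hp) (NN_ne_top hp (Np_sub hp hf hg))
  · rw [dM_sub hp hf hg] at h
    have h1 := (mul_eq_zero.1 h).resolve_left (cc_ne_zero hp)
    exact sub_eq_zero.1 (NN_zero_iff hp (Np_sub hp hf hg) h1 hz)
  · have hp0 : 0 < p := by linarith
    rw [dM_eq hp]
    simp [NN, rl_congr h, lg_zero, hp0]
  · simp_rw [smul_eq_const_mul]
    exact mul_cont hp (fun n => Np_const hp (c n)) hF (Np_const hp c₀) hf (const_cont hp hc) h
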